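/- Let T be a locally satisfiable negative local theory, x a pointed variable, and Γ a set of local positive formulas on x. Then Γ is a local positive type of T if and only if Γ = ltp^M_+(a) for some local positively closed model M of T and some tuple a ∈ M^x. -/

import Mathlib

noncomputable section

structure LocalLanguage : Type 1 where
  Sorts : Type
  Rel : (n : ℕ) → (Fin n → Sorts) → Type
  Const : Sorts → Type
  Loc : Sorts → Type
  locToRel : {s : Sorts} → Loc s → Rel 2 ![s, s]
  dd0 : (s : Sorts) → Loc s
  locMul : {s : Sorts} → Loc s → Loc s → Loc s
  locLe : {s : Sorts} → Loc s → Loc s → Prop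
  locMul_assoc : ∀ {s} (d₁ d₂ d₃ : Loc s), locMul (locMul d₁ d₂) d₃ = locMul d₁ (locMul d₂ d₃)
  dd0_locMul : ∀ {s} (d : Loc s), locMul (dd0 s) d = d
  locMul_dd0 : ∀ {s} (d : Loc s), locMul d (dd0 s) = d
  locLe_refl : ∀ {s} (d : Loc s), locLe d d
  locLe_trans : ∀ {s} (d₁ d₂ d₃ : Loc s), locLe d₁ d₂ → locLe d₂ d₃ → locLe d₁ d₃
  locLe_antisymm : ∀ {s} (d₁ d₂ : Loc s), locLe d₁ d₂ → locLe d₂ d₁ → d₁ = d₂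
  dd0_locLe : ∀ {s} (d : Loc s), locLe (dd0 s) d
  locMul_mono : ∀ {s} (d₁ d₂ e₁ e₂ : Loc s), locLe d₁ e₁ → locLe d₂ e₂ →
    locLe (locMul d₁ d₂) (locMul e₁ e₂)
  bound : {s : Sorts} → Const s → Const s → Loc s

structure LStructure (L : LocalLanguage) : Type 1 where
  Dom : L.Sorts → Type
  relMap : {n : ℕ} → {ρ : Fin n → L.Sorts} → L.Rel n ρ → ((i : Fin n) → Dom (ρ i)) → Prop
  constMap : {s : L.Sorts} → L.Const s → Dom s

def dpair {C : Fin 2 → Sort*} (a : C 0) (b : C 1) : (i : Fin 2) → C i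
  | ⟨0, _⟩ => a
  | ⟨1, _⟩ => b

def LStructure.locRel {L : LocalLanguage} (M : LStructure L) {s : L.Sorts}
    (d : L.Loc s) (a b : M.Dom s) : Prop :=
  M.relMap (L.locToRel d) (dpair a b)

structure IsLocal {L : LocalLanguage} (M : LStructure L) : Prop where
  symm : ∀ {s : L.Sorts} (d : L.Loc s) (a b : M.Dom s), M.locRel d a b → M.locRel d b a
  mono : ∀ {s : L.Sorts} (d₁ d₂ : L.Loc s), L.locLe d₁ d₂ →
    ∀ (a b : M.Dom s), M.locRel d₁ a b → M.locRel d₂ a b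
  comp : ∀ {s : L.Sorts} (d₁ d₂ : L.Loc s) (a b c : M.Dom s),
    M.locRel d₁ a b → M.locRel d₂ b c → M.locRel (L.locMul d₁ d₂) a c
  boundAx : ∀ {s : L.Sorts} (c₁ c₂ : L.Const s),
    M.locRel (L.bound c₁ c₂) (M.constMap c₁) (M.constMap c₂)
  total : ∀ {s : L.Sorts} (a b : M.Dom s), ∃ d : L.Loc s, M.locRel d a b
  dd0_eq : ∀ {s : L.Sorts} (a b : M.Dom s), M.locRel (L.dd0 s) a b ↔ a = b

/-! ## Syntax -/

/-- Terms: variables or constants (the language is relational). -/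
inductive LTerm (L : LocalLanguage) (α : Type) (σ : α → L.Sorts) : L.Sorts → Type
  | var (a : α) : LTerm L α σ (σ a)
  | const {s : L.Sorts} (c : L.Const s) : LTerm L α σ s

/-- Sort assignment for a context extended by one variable of sort `s`. -/
abbrev osort {L : LocalLanguage} {α : Type} (s : L.Sorts) (σ : α → L.Sorts) :
    Option α → L.Sorts :=
  fun o => Option.elim o s σ

/-- Positive formulas: atomic, conjunction, disjunction, existential quantification. -/
inductive PosForm (L : LocalLanguage) : (α : Type) → (α → L.Sorts) → Type 1
  | rel {α : Type} {σ : α → L.Sorts} {n : ℕ} {ρ : Fin n → L.Sorts}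
      (R : L.Rel n ρ) (ts : (i : Fin n) → LTerm L α σ (ρ i)) : PosForm L α σ
  | and {α : Type} {σ : α → L.Sorts} (φ ψ : PosForm L α σ) : PosForm L α σ
  | or {α : Type} {σ : α → L.Sorts} (φ ψ : PosForm L α σ) : PosForm L α σ
  | ex {α : Type} {σ : α → L.Sorts} (s : L.Sorts)
      (φ : PosForm L (Option α) (osort s σ)) : PosForm L α σ

/-- Local positive formulas: atomic, conjunction, disjunction, local existential
quantification `∃ x ∈ d(t) φ`. -/
inductive LPosForm (L : LocalLanguage) : (α : Type) → (α → L.Sorts) → Type 1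
  | rel {α : Type} {σ : α → L.Sorts} {n : ℕ} {ρ : Fin n → L.Sorts}
      (R : L.Rel n ρ) (ts : (i : Fin n) → LTerm L α σ (ρ i)) : LPosForm L α σ
  | and {α : Type} {σ : α → L.Sorts} (φ ψ : LPosForm L α σ) : LPosForm L α σ
  | or {α : Type} {σ : α → L.Sorts} (φ ψ : LPosForm L α σ) : LPosForm L α σ
  | lex {α : Type} {σ : α → L.Sorts} (s : L.Sorts) (d : L.Loc s) (t : LTerm L α σ s)
      (φ : LPosForm L (Option α) (osort s σ)) : LPosForm L α σ

/-- Local formulas: atomic, negation, conjunction, local existential quantification. -/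
inductive LForm (L : LocalLanguage) : (α : Type) → (α → L.Sorts) → Type 1
  | rel {α : Type} {σ : α → L.Sorts} {n : ℕ} {ρ : Fin n → L.Sorts}
      (R : L.Rel n ρ) (ts : (i : Fin n) → LTerm L α σ (ρ i)) : LForm L α σ
  | not {α : Type} {σ : α → L.Sorts} (φ : LForm L α σ) : LForm L α σ
  | and {α : Type} {σ : α → L.Sorts} (φ ψ : LForm L α σ) : LForm L α σ
  | lex {α : Type} {σ : α → L.Sorts} (s : L.Sorts) (d : L.Loc s) (t : LTerm L α σ s)
      (φ : LForm L (Option α) (osort s σ)) : LForm L α σ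

/-! ## Semantics -/

def LTerm.realize {L : LocalLanguage} (M : LStructure L) {α : Type} {σ : α → L.Sorts}
    (v : (a : α) → M.Dom (σ a)) : {s : L.Sorts} → LTerm L α σ s → M.Dom s
  | _, .var a => v a
  | _, .const c => M.constMap c

/-- Extension of a valuation by a value for the new variable. -/
def vcons {L : LocalLanguage} {M : LStructure L} {α : Type} {σ : α → L.Sorts} {s : L.Sorts}
    (x : M.Dom s) (v : (a : α) → M.Dom (σ a)) : (o : Option α) → M.Dom (osort s σ o)
  | none => x
  | some a => v a

def PosForm.Realize {L : LocalLanguage} (M : LStructure L) :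
    {α : Type} → {σ : α → L.Sorts} → PosForm L α σ → ((a : α) → M.Dom (σ a)) → Prop
  | _, _, .rel R ts, v => M.relMap R (fun i => (ts i).realize M v)
  | _, _, .and φ ψ, v => φ.Realize M v ∧ ψ.Realize M v
  | _, _, .or φ ψ, v => φ.Realize M v ∨ ψ.Realize M v
  | _, _, .ex s φ, v => ∃ x : M.Dom s, φ.Realize M (vcons x v)

def LPosForm.Realize {L : LocalLanguage} (M : LStructure L) :
    {α : Type} → {σ : α → L.Sorts} → LPosForm L α σ → ((a : α) → M.Dom (σ a)) → Prop
  | _, _, .rel R ts, v => M.relMap R (fun i => (ts i).realize M v)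
  | _, _, .and φ ψ, v => φ.Realize M v ∧ ψ.Realize M v
  | _, _, .or φ ψ, v => φ.Realize M v ∨ ψ.Realize M v
  | _, _, .lex s d t φ, v =>
      ∃ x : M.Dom s, M.locRel d x (t.realize M v) ∧ φ.Realize M (vcons x v)

def LForm.Realize {L : LocalLanguage} (M : LStructure L) :
    {α : Type} → {σ : α → L.Sorts} → LForm L α σ → ((a : α) → M.Dom (σ a)) → Prop
  | _, _, .rel R ts, v => M.relMap R (fun i => (ts i).realize M v)
  | _, _, .not φ, v => ¬ φ.Realize M v
  | _, _, .and φ ψ, v => φ.Realize M v ∧ ψ.Realize M v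
  | _, _, .lex s d t φ, v =>
      ∃ x : M.Dom s, M.locRel d x (t.realize M v) ∧ φ.Realize M (vcons x v)

/-- Quantifier-free positive formulas. -/
inductive PosForm.IsQF {L : LocalLanguage} : {α : Type} → {σ : α → L.Sorts} → PosForm L α σ → Prop
  | rel {α : Type} {σ : α → L.Sorts} {n : ℕ} {ρ : Fin n → L.Sorts}
      (R : L.Rel n ρ) (ts : (i : Fin n) → LTerm L α σ (ρ i)) : PosForm.IsQF (.rel R ts)
  | and {α : Type} {σ : α → L.Sorts} {φ ψ : PosForm L α σ} :
      PosForm.IsQF φ → PosForm.IsQF ψ → PosForm.IsQF (.and φ ψ)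
  | or {α : Type} {σ : α → L.Sorts} {φ ψ : PosForm L α σ} :
      PosForm.IsQF φ → PosForm.IsQF ψ → PosForm.IsQF (.or φ ψ)


/-! ## Sentences, theories, models -/

/-- Sort assignment for the empty context. -/
abbrev emptySorts (L : LocalLanguage) : Empty → L.Sorts := fun e => e.elim

/-- Positive sentences. -/
abbrev PosSentence (L : LocalLanguage) := PosForm L Empty (emptySorts L)

/-- A positive sentence holds in a structure. -/
def PosSentence.RealizedIn {L : LocalLanguage} (φ : PosSentence L) (M : LStructure L) : Prop :=
  φ.Realize M (fun e => e.elim)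

/-- We represent a negative theory by the set of positive sentences whose negations
belong to it.  `M` is a local model of `T` if `M` is local and satisfies the negation of
every positive sentence in `T`. -/
def LocalModel {L : LocalLanguage} (M : LStructure L) (T : Set (PosSentence L)) : Prop :=
  IsLocal M ∧ ∀ φ ∈ T, ¬ φ.RealizedIn M

/-- `T` (a set of positive sentences standing for the negative theory `{¬φ : φ ∈ T}`)
is a negative local theory if it is closed under local implication: any negative sentence
true in every local model of `T` is already in `T`. -/
def IsNegLocalTheory {L : LocalLanguage} (T : Set (PosSentence L)) : Prop :=
  ∀ φ : PosSentence L, (∀ M : LStructure L, LocalModel M T → ¬ φ.RealizedIn M) → φ ∈ T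

/-- `T` is locally satisfiable: it has a local model. -/
def LocSat {L : LocalLanguage} (T : Set (PosSentence L)) : Prop :=
  ∃ M : LStructure L, LocalModel M T

/-- The negative theory of a structure (as the set of positive sentences failing in it). -/
def ThNeg {L : LocalLanguage} (M : LStructure L) : Set (PosSentence L) :=
  {φ | ¬ φ.RealizedIn M}

/-! ## Homomorphisms -/

structure LHom {L : LocalLanguage} (M N : LStructure L) where
  toFun : (s : L.Sorts) → M.Dom s → N.Dom s
  map_rel : ∀ {n : ℕ} {ρ : Fin n → L.Sorts} (R : L.Rel n ρ) (x : (i : Fin n) → M.Dom (ρ i)),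
    M.relMap R x → N.relMap R (fun i => toFun (ρ i) (x i))
  map_const : ∀ {s : L.Sorts} (c : L.Const s), toFun s (M.constMap c) = N.constMap c

def LHom.comp {L : LocalLanguage} {M N P : LStructure L} (g : LHom N P) (f : LHom M N) :
    LHom M P where
  toFun s := g.toFun s ∘ f.toFun s
  map_rel R x h := g.map_rel R _ (f.map_rel R x h)
  map_const c := by
    simp only [Function.comp_apply, f.map_const, g.map_const]

def LHom.id {L : LocalLanguage} (M : LStructure L) : LHom M M where
  toFun _ := fun x => x
  map_rel _ _ h := h
  map_const _ := rfl

/-- A homomorphism is a positive embedding if it reflects all positive formulas. -/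
def LHom.IsPosEmbedding {L : LocalLanguage} {M N : LStructure L} (h : LHom M N) : Prop :=
  ∀ (α : Type) (σ : α → L.Sorts) (φ : PosForm L α σ) (v : (a : α) → M.Dom (σ a)),
    φ.Realize N (fun a => h.toFun (σ a) (v a)) → φ.Realize M v

/-- A local positively closed model of `T`. -/
def IsPC {L : LocalLanguage} (M : LStructure L) (T : Set (PosSentence L)) : Prop :=
  LocalModel M T ∧
    ∀ (N : LStructure L) (h : LHom M N), LocalModel N T → h.IsPosEmbedding

/-- An endomorphism is an automorphism if it has a two-sided inverse homomorphism. -/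
def LHom.IsAuto {L : LocalLanguage} {M : LStructure L} (f : LHom M M) : Prop :=
  ∃ g : LHom M M, g.comp f = LHom.id M ∧ f.comp g = LHom.id M

/-- Isomorphism of structures. -/
def Isomorphic {L : LocalLanguage} (M N : LStructure L) : Prop :=
  ∃ (f : LHom M N) (g : LHom N M), g.comp f = LHom.id M ∧ f.comp g = LHom.id N

/-! ## Types -/

/-- The local positive type of a tuple. -/
def ltp {L : LocalLanguage} (M : LStructure L) {α : Type} {σ : α → L.Sorts}
    (v : (a : α) → M.Dom (σ a)) : Set (LPosForm L α σ) :=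
  {φ | φ.Realize M v}

/-- The positive type of a tuple. -/
def ptp {L : LocalLanguage} (M : LStructure L) {α : Type} {σ : α → L.Sorts}
    (v : (a : α) → M.Dom (σ a)) : Set (PosForm L α σ) :=
  {φ | φ.Realize M v}

/-- A partial local positive type of `T` on `(α, σ)`: a set of local positive formulas
realized by some tuple in some local model of `T`. -/
def IsPartialLType {L : LocalLanguage} (T : Set (PosSentence L)) {α : Type}
    {σ : α → L.Sorts} (Γ : Set (LPosForm L α σ)) : Prop :=
  ∃ (M : LStructure L) (v : (a : α) → M.Dom (σ a)),
    LocalModel M T ∧ ∀ φ ∈ Γ, LPosForm.Realize M φ v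

/-- A local positive type: a maximal partial local positive type. -/
def IsLType {L : LocalLanguage} (T : Set (PosSentence L)) {α : Type}
    {σ : α → L.Sorts} (Γ : Set (LPosForm L α σ)) : Prop :=
  IsPartialLType T Γ ∧ ∀ Γ' : Set (LPosForm L α σ), IsPartialLType T Γ' → Γ ⊆ Γ' → Γ' = Γ

/-- A variable `(α, σ)` is pointed if every sort not occurring among its sorts carries a
constant symbol. -/
def VPointed {L : LocalLanguage} {α : Type} (σ : α → L.Sorts) : Prop :=
  ∀ s : L.Sorts, s ∉ Set.range σ → Nonempty (L.Const s)


/-! ## Bounds and bounded satisfiability -/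

/-- Pair of terms as arguments for a binary relation symbol. -/
def tpair {L : LocalLanguage} {α : Type} {σ : α → L.Sorts} {s t : L.Sorts}
    (t₁ : LTerm L α σ s) (t₂ : LTerm L α σ t) : (i : Fin 2) → LTerm L α σ (![s, t] i) :=
  dpair t₁ t₂

/-- A bound of the variable `(α, σ)`: a choice, for every single variable whose sort
carries a constant symbol, of a locality relation and a constant, and for every pair of
single variables of the same sort, of a locality relation. -/
structure VBound (L : LocalLanguage) (α : Type) (σ : α → L.Sorts) where
  dConst : (a : α) → Nonempty (L.Const (σ a)) → L.Loc (σ a)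
  cConst : (a : α) → Nonempty (L.Const (σ a)) → L.Const (σ a)
  dPair : (a b : α) → σ a = σ b → L.Loc (σ a)

/-- The set of (atomic, quantifier-free) local positive formulas making up a bound:
`d_a(x_a, c_a)` and `d_{a,b}(x_a, x_b)`. -/
def VBound.toSet {L : LocalLanguage} {α : Type} {σ : α → L.Sorts} (B : VBound L α σ) :
    Set (LPosForm L α σ) :=
  {φ | (∃ (a : α) (h : Nonempty (L.Const (σ a))),
          φ = LPosForm.rel (L.locToRel (B.dConst a h))
                (tpair (LTerm.var a) (LTerm.const (B.cConst a h)))) ∨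
       (∃ (a b : α) (e : σ a = σ b),
          φ = LPosForm.rel (L.locToRel (B.dPair a b e))
                (tpair (LTerm.var a) (e.symm ▸ LTerm.var b)))}

/-- A bound holds of a tuple if all its formulas do. -/
def VBound.Holds {L : LocalLanguage} {α : Type} {σ : α → L.Sorts} (B : VBound L α σ)
    (M : LStructure L) (v : (a : α) → M.Dom (σ a)) : Prop :=
  ∀ ψ ∈ B.toSet, LPosForm.Realize M ψ v

/-- Finite local satisfiability of a set of local positive formulas in `T`. -/
def FinLocSat {L : LocalLanguage} (T : Set (PosSentence L)) {α : Type} {σ : α → L.Sorts}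
    (Δ : Set (LPosForm L α σ)) : Prop :=
  ∀ Δ₀ ⊆ Δ, Δ₀.Finite →
    ∃ (M : LStructure L) (v : (a : α) → M.Dom (σ a)),
      LocalModel M T ∧ ∀ φ ∈ Δ₀, LPosForm.Realize M φ v

/-- Bounded satisfiability: for some bound `B`, `Γ ∪ B` is finitely locally satisfiable. -/
def BoundedlySat {L : LocalLanguage} (T : Set (PosSentence L)) {α : Type}
    {σ : α → L.Sorts} (Γ : Set (LPosForm L α σ)) : Prop :=
  ∃ B : VBound L α σ, FinLocSat T (Γ ∪ B.toSet)

/-! ## Π₁-local formulas -/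

/-- Dependent `Sum.elim` of valuations. -/
def sval {L : LocalLanguage} {M : LStructure L} {α β : Type} {σ : α → L.Sorts}
    {τ : β → L.Sorts} (v : (a : α) → M.Dom (σ a)) (w : (b : β) → M.Dom (τ b)) :
    (x : α ⊕ β) → M.Dom (Sum.elim σ τ x)
  | .inl a => v a
  | .inr b => w b

/-- A Π₁-local formula: a universally quantified local formula. -/
structure Pi1LForm (L : LocalLanguage) (α : Type) (σ : α → L.Sorts) : Type 1 where
  n : ℕ
  τ : Fin n → L.Sorts
  matrix : LForm L (α ⊕ Fin n) (Sum.elim σ τ)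

def Pi1LForm.Realize {L : LocalLanguage} {α : Type} {σ : α → L.Sorts}
    (φ : Pi1LForm L α σ) (M : LStructure L) (v : (a : α) → M.Dom (σ a)) : Prop :=
  ∀ w : (i : Fin φ.n) → M.Dom (φ.τ i), φ.matrix.Realize M (sval v w)

/-- Bounded satisfiability of a set of Π₁-local formulas: for some bound `B`, every
finite subset of `Γ` together with every finite part of `B` is realized in a local
model of `T`. -/
def Pi1BoundedlySat {L : LocalLanguage} (T : Set (PosSentence L)) {α : Type}
    {σ : α → L.Sorts} (Γ : Set (Pi1LForm L α σ)) : Prop :=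
  ∃ B : VBound L α σ,
    ∀ Γ₀ ⊆ Γ, Γ₀.Finite → ∀ F ⊆ B.toSet, F.Finite →
      ∃ (M : LStructure L) (v : (a : α) → M.Dom (σ a)),
        LocalModel M T ∧ (∀ φ ∈ Γ₀, Pi1LForm.Realize φ M v) ∧
          (∀ ψ ∈ F, LPosForm.Realize M ψ v)

/-! ## Cardinality, homogeneity, retractors -/

/-- The cardinality of a structure: that of the disjoint union of its sorts. -/
def LStructure.card {L : LocalLanguage} (M : LStructure L) : Cardinal :=
  Cardinal.mk (Σ s : L.Sorts, M.Dom s)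

/-- The cardinality of a local language. -/
def LocalLanguage.card (L : LocalLanguage) : Cardinal :=
  max Cardinal.aleph0
    (Cardinal.mk (L.Sorts ⊕ (Σ s : L.Sorts, L.Const s) ⊕ (Σ s : L.Sorts, L.Loc s) ⊕
      (Σ (n : ℕ) (ρ : Fin n → L.Sorts), L.Rel n ρ)))

/-- `M` is a (local positively) κ-ultrahomogeneous model of `T`. -/
def IsUltrahomogeneous {L : LocalLanguage} (T : Set (PosSentence L)) (M : LStructure L)
    (κ : Cardinal) : Prop :=
  ∀ A B : LStructure L, LocalModel A T → LocalModel B T → A.card < κ → B.card < κ →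
    ∀ f : LHom A M, f.IsPosEmbedding → ∀ g : LHom A B, ∃ h : LHom B M, h.comp g = f

/-- A retractor of `T`: a local model of `T` such that every homomorphism into a local
model of `T` has a retraction. -/
def IsRetractor {L : LocalLanguage} (T : Set (PosSentence L)) (C : LStructure L) : Prop :=
  LocalModel C T ∧
    ∀ N : LStructure L, LocalModel N T →
      ∀ f : LHom C N, ∃ g : LHom N C, g.comp f = LHom.id C

/-- `M` is κ-universal for a class `K` of structures. -/
def IsUniversal {L : LocalLanguage} (M : LStructure L) (K : LStructure L → Prop)
    (κ : Cardinal) : Prop :=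
  ∀ N : LStructure L, K N → N.card < κ → Nonempty (LHom N M)

/-- `M` is absolutely universal for a class `K` of structures. -/
def IsAbsUniversal {L : LocalLanguage} (M : LStructure L) (K : LStructure L → Prop) : Prop :=
  ∀ N : LStructure L, K N → Nonempty (LHom N M)

/-- Compatibility of two local models of `T`. -/
def Compat {L : LocalLanguage} (T : Set (PosSentence L)) (A B : LStructure L) : Prop :=
  ∃ M : LStructure L, LocalModel M T ∧ Nonempty (LHom A M) ∧ Nonempty (LHom B M)

/-- The local joint (homomorphism) property. -/
def HasLJP {L : LocalLanguage} (T : Set (PosSentence L)) : Prop :=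
  ∀ A B : LStructure L, LocalModel A T → LocalModel B T →
    ∃ M : LStructure L, LocalModel M T ∧ Nonempty (LHom A M) ∧ Nonempty (LHom B M)


/-! ## Parameters -/

/-- A set of parameters in a structure. -/
def ParamSet {L : LocalLanguage} (M : LStructure L) := (s : L.Sorts) → Set (M.Dom s)

/-- Interpretation in `M` of old and new constants of the expanded language. -/
def paramInterp {L : LocalLanguage} (M : LStructure L) (A : ParamSet M) {s : L.Sorts} :
    L.Const s ⊕ (A s) → M.Dom s
  | .inl c => M.constMap c
  | .inr a => a.1

/-- The expansion `L(A)` of `L` by new constants for the parameters `A` of a local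
structure `M`; bounds for pairs involving the new constants are chosen (by locality
axiom (A5)) so that they hold in `M`. -/
noncomputable def LocalLanguage.withParams (L : LocalLanguage) (M : LStructure L)
    (hM : IsLocal M) (A : ParamSet M) : LocalLanguage where
  Sorts := L.Sorts
  Rel := L.Rel
  Const s := L.Const s ⊕ (A s)
  Loc := L.Loc
  locToRel := L.locToRel
  dd0 := L.dd0
  locMul := L.locMul
  locLe := L.locLe
  locMul_assoc := L.locMul_assoc
  dd0_locMul := L.dd0_locMul
  locMul_dd0 := L.locMul_dd0
  locLe_refl := L.locLe_refl
  locLe_trans := L.locLe_trans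
  locLe_antisymm := L.locLe_antisymm
  dd0_locLe := L.dd0_locLe
  locMul_mono := L.locMul_mono
  bound := fun {_s} c₁ c₂ =>
    match c₁, c₂ with
    | .inl c₁, .inl c₂ => L.bound c₁ c₂
    | c₁, c₂ => Classical.choose (hM.total (paramInterp M A c₁) (paramInterp M A c₂))

/-- The natural expansion `M_A` of `M` to an `L(A)`-structure. -/
noncomputable def LStructure.withParams {L : LocalLanguage} (M : LStructure L)
    (hM : IsLocal M) (A : ParamSet M) : LStructure (L.withParams M hM A) where
  Dom := M.Dom
  relMap := M.relMap
  constMap := paramInterp M A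

/-- `M` has the local joint property over `A`: any two local models of `Th₋(M/A)` map
into a common local model of `Th₋(M/A)`. -/
def HasLJPOver {L : LocalLanguage} (M : LStructure L) (hM : IsLocal M) (A : ParamSet M) :
    Prop :=
  HasLJP (ThNeg (M.withParams hM A))

/-- `M` is (local positively) κ-saturated: it realizes every local positive type of
`Th₋(M/A)` on `x` whenever `|x| < κ`, `|A| < κ` and `M` has the local joint property
over `A`. -/
def IsSaturatedAt {L : LocalLanguage} (M : LStructure L) (hM : IsLocal M)
    (κ : Cardinal) : Prop :=
  ∀ A : ParamSet M, Cardinal.mk (Σ s : L.Sorts, A s) < κ → HasLJPOver M hM A →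
    ∀ (α : Type) (σ : α → L.Sorts), Cardinal.mk α < κ →
      ∀ Γ : Set (LPosForm (L.withParams M hM A) α σ),
        IsLType (ThNeg (M.withParams hM A)) Γ →
          ∃ v : (a : α) → M.Dom (σ a), ∀ φ ∈ Γ, LPosForm.Realize (M.withParams hM A) φ v

/-- The local positive type of a tuple over a set of parameters `A`, rendered as the set
of local positive formulas with extra free variables for the parameters of `A` that are
satisfied when those variables are evaluated at the parameters themselves. -/
def ltpOver {L : LocalLanguage} (M : LStructure L) (A : ParamSet M) {α : Type}
    {σ : α → L.Sorts} (v : (a : α) → M.Dom (σ a)) :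
    Set (LPosForm L (α ⊕ Σ s : L.Sorts, A s) (Sum.elim σ (fun p => p.1))) :=
  {φ | φ.Realize M (sval v (fun p => p.2.1))}

/-! ## Substructures -/

/-- A substructure of `M`: a family of subsets closed under the constants (the language
is relational). -/
structure Substruct {L : LocalLanguage} (M : LStructure L) where
  carrier : (s : L.Sorts) → Set (M.Dom s)
  const_mem : ∀ {s : L.Sorts} (c : L.Const s), M.constMap c ∈ carrier s

/-- The induced structure on a substructure. -/
def Substruct.toStruct {L : LocalLanguage} {M : LStructure L} (A : Substruct M) :
    LStructure L where
  Dom s := A.carrier s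
  relMap R x := M.relMap R (fun i => (x i).1)
  constMap c := ⟨M.constMap c, A.const_mem c⟩


/-! ## Topologies -/

/-- The `d`-ball at `a`. -/
def LStructure.ball {L : LocalLanguage} (M : LStructure L) {s : L.Sorts} (d : L.Loc s)
    (a : M.Dom s) : Set (M.Dom s) :=
  {b | M.locRel d a b}

/-- The local positive logic topology on a single sort of `M`: closed sets are the
subsets defined by sets of local positive formulas with parameters in `M` (parameters
being rendered as extra free variables evaluated at themselves). -/
def lpTopologyS {L : LocalLanguage} (M : LStructure L) (s : L.Sorts) :
    TopologicalSpace (M.Dom s) :=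
  TopologicalSpace.generateFrom
    {U | ∃ φ : LPosForm L (Unit ⊕ Σ s' : L.Sorts, M.Dom s')
            (Sum.elim (fun _ => s) (fun p => p.1)),
      U = {x | ¬ LPosForm.Realize M φ (sval (fun _ => x) (fun p => p.2))}}

/-- The space of local positive types of `T` on the variable `(α, σ)`. -/
def LTypeSpace (L : LocalLanguage) (T : Set (PosSentence L)) (α : Type)
    (σ : α → L.Sorts) :=
  {Γ : Set (LPosForm L α σ) // IsLType T Γ}

/-- The local positive logic topology on the space of local positive types: generated by
declaring `⟨φ⟩ = {p : φ ∈ p}` closed for every local positive formula `φ`; its closed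
sets are then exactly the sets `⟨Γ⟩` together with `∅`. -/
instance {L : LocalLanguage} (T : Set (PosSentence L)) (α : Type) (σ : α → L.Sorts) :
    TopologicalSpace (LTypeSpace L T α σ) :=
  TopologicalSpace.generateFrom
    {U | ∃ φ : LPosForm L α σ, U = {p : LTypeSpace L T α σ | φ ∉ p.1}}

/-! ## Completeness and compactness -/

/-- `T` is complete: `T = Th₋(M)` for every local positively closed model `M` of `T`. -/
def IsCompleteTheory {L : LocalLanguage} (T : Set (PosSentence L)) : Prop :=
  ∀ M : LStructure L, IsPC M T → ThNeg M = T

/-- `T` is local positively compact. -/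
def IsLocPosCompact {L : LocalLanguage} (T : Set (PosSentence L)) : Prop :=
  ∀ (s : L.Sorts) (γ : Type), Finite γ →
    ∀ (τ : γ → L.Sorts) (φ : LPosForm L (Fin 2 ⊕ γ) (Sum.elim (fun _ => s) τ)),
      (∀ M : LStructure L, LocalModel M T →
        ∀ (a : M.Dom s) (w : (j : γ) → M.Dom (τ j)),
          ¬ LPosForm.Realize M φ (sval ![a, a] w)) →
      ∀ (B : VBound L (Unit ⊕ γ) (Sum.elim (fun _ => s) τ)) (d : L.Loc s),
        ∃ k : ℕ, 0 < k ∧ ∀ M : LStructure L, LocalModel M T →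
          ¬ ∃ (a : Fin k → M.Dom s) (w : (j : γ) → M.Dom (τ j)),
            ∀ i j : Fin k, i ≠ j →
              B.Holds M (sval (fun _ => a i) w) ∧ M.locRel d (a i) (a j) ∧
                LPosForm.Realize M φ (sval ![a i, a j] w)

/-! ## Homomorphisms and positive formulas -/

theorem comp_dpair {S : Type} {A B : S → Type} (g : ∀ s, A s → B s) {s t : S} (x : A s)
    (y : A t) :
    (fun j => g (![s, t] j) (dpair (C := fun j => A (![s, t] j)) x y j)) =
      dpair (C := fun j => B (![s, t] j)) (g s x) (g t y) := by
  funext j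
  match j with
  | ⟨0, _⟩ => rfl
  | ⟨1, _⟩ => rfl

theorem comp_vcons {L : LocalLanguage} {M N : LStructure L} (g : ∀ s, M.Dom s → N.Dom s)
    {α : Type} {σ : α → L.Sorts} {s : L.Sorts} (x : M.Dom s) (v : (a : α) → M.Dom (σ a)) :
    (fun o => g (osort s σ o) (vcons x v o)) =
      (vcons (g s x) (fun a => g (σ a) (v a)) : (o : Option α) → N.Dom (osort s σ o)) := by
  funext o
  cases o <;> rfl

/-- Weakening of a term to a context with one more variable. -/
def LTerm.lift {L : LocalLanguage} {α : Type} {σ : α → L.Sorts} (s₀ : L.Sorts) :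
    {s : L.Sorts} → LTerm L α σ s → LTerm L (Option α) (osort s₀ σ) s
  | _, .var a => .var (σ := osort s₀ σ) (some a)
  | _, .const c => .const c

theorem LTerm.realize_lift {L : LocalLanguage} {M : LStructure L} {α : Type} {σ : α → L.Sorts}
    {s₀ s : L.Sorts} (t : LTerm L α σ s) (x : M.Dom s₀) (v : (a : α) → M.Dom (σ a)) :
    (t.lift s₀).realize M (vcons x v) = t.realize M v := by
  cases t <;> rfl

/-- Substitution of terms for variables. -/
def LTerm.subst {L : LocalLanguage} {α β : Type} {σ : α → L.Sorts} {τ : β → L.Sorts}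
    (g : (a : α) → LTerm L β τ (σ a)) : {s : L.Sorts} → LTerm L α σ s → LTerm L β τ s
  | _, .var a => g a
  | _, .const c => .const c

theorem LTerm.realize_subst {L : LocalLanguage} {M : LStructure L} {α β : Type}
    {σ : α → L.Sorts} {τ : β → L.Sorts} (g : (a : α) → LTerm L β τ (σ a)) {s : L.Sorts}
    (t : LTerm L α σ s) (v : (b : β) → M.Dom (τ b)) :
    (t.subst g).realize M v = t.realize M (fun a => (g a).realize M v) := by
  cases t <;> rfl

theorem LTerm.realize_hom {L : LocalLanguage} {M N : LStructure L} (h : LHom M N) {α : Type}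
    {σ : α → L.Sorts} {s : L.Sorts} (t : LTerm L α σ s) (v : (a : α) → M.Dom (σ a)) :
    t.realize N (fun a => h.toFun _ (v a)) = h.toFun s (t.realize M v) := by
  cases t with
  | var a => rfl
  | const c => exact (h.map_const c).symm

theorem LTerm.realize_tpair {L : LocalLanguage} {M : LStructure L} {α : Type} {σ : α → L.Sorts}
    {s t : L.Sorts} (t₁ : LTerm L α σ s) (t₂ : LTerm L α σ t) (v : (a : α) → M.Dom (σ a)) :
    (fun i => (tpair t₁ t₂ i).realize M v) =
      dpair (C := fun i => M.Dom (![s, t] i)) (t₁.realize M v) (t₂.realize M v) :=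
  comp_dpair (A := LTerm L α σ) (B := M.Dom) (fun _ t => t.realize M v) t₁ t₂

theorem PosForm.realize_locRel {L : LocalLanguage} {M : LStructure L} {α : Type}
    {σ : α → L.Sorts} {s : L.Sorts} (d : L.Loc s) (t₁ t₂ : LTerm L α σ s)
    (v : (a : α) → M.Dom (σ a)) :
    (PosForm.rel (L.locToRel d) (tpair t₁ t₂)).Realize M v ↔
      M.locRel d (t₁.realize M v) (t₂.realize M v) :=
  Iff.of_eq (congrArg (M.relMap (L.locToRel d)) (LTerm.realize_tpair t₁ t₂ v))

theorem PosForm.Realize.map {L : LocalLanguage} {M N : LStructure L} (h : LHom M N) {α : Type}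
    {σ : α → L.Sorts} (φ : PosForm L α σ) (v : (a : α) → M.Dom (σ a)) (hφ : φ.Realize M v) :
    φ.Realize N (fun a => h.toFun _ (v a)) := by
  induction φ with
  | rel R ts =>
    simp only [PosForm.Realize, LTerm.realize_hom] at hφ ⊢
    exact h.map_rel R _ hφ
  | and φ ψ ih₁ ih₂ => exact ⟨ih₁ v hφ.1, ih₂ v hφ.2⟩
  | or φ ψ ih₁ ih₂ => exact hφ.imp (ih₁ v) (ih₂ v)
  | ex s φ ih =>
    obtain ⟨x, hx⟩ := hφ
    have := ih _ hx
    rw [comp_vcons h.toFun] at this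
    exact ⟨_, this⟩

theorem PosSentence.RealizedIn.map {L : LocalLanguage} {M N : LStructure L} (h : LHom M N)
    {φ : PosSentence L} (hφ : φ.RealizedIn M) : φ.RealizedIn N := by
  have := PosForm.Realize.map h φ _ hφ
  unfold PosSentence.RealizedIn
  convert this using 1

/-- A local positive formula, seen as a positive formula. -/
def LPosForm.toPos {L : LocalLanguage} :
    {α : Type} → {σ : α → L.Sorts} → LPosForm L α σ → PosForm L α σ
  | _, _, .rel R ts => .rel R ts
  | _, _, .and φ ψ => .and φ.toPos ψ.toPos
  | _, _, .or φ ψ => .or φ.toPos ψ.toPos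
  | _, σ, .lex s d t φ =>
      .ex s (.and (.rel (L.locToRel d) (tpair (.var (σ := osort s σ) none) (t.lift s))) φ.toPos)

theorem LPosForm.realize_toPos {L : LocalLanguage} {M : LStructure L} {α : Type}
    {σ : α → L.Sorts} (φ : LPosForm L α σ) (v : (a : α) → M.Dom (σ a)) :
    φ.toPos.Realize M v ↔ φ.Realize M v := by
  induction φ with
  | rel R ts => rfl
  | and φ ψ ih₁ ih₂ => exact and_congr (ih₁ v) (ih₂ v)
  | or φ ψ ih₁ ih₂ => exact or_congr (ih₁ v) (ih₂ v)
  | lex s d t φ ih =>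
    refine exists_congr fun x => and_congr ((PosForm.realize_locRel d _ _ _).trans ?_) (ih _)
    rw [LTerm.realize_lift]
    rfl

theorem LPosForm.Realize.map {L : LocalLanguage} {M N : LStructure L} (h : LHom M N) {α : Type}
    {σ : α → L.Sorts} (φ : LPosForm L α σ) (v : (a : α) → M.Dom (σ a)) (hφ : φ.Realize M v) :
    φ.Realize N (fun a => h.toFun _ (v a)) :=
  (φ.realize_toPos _).1 (PosForm.Realize.map h _ v ((φ.realize_toPos _).2 hφ))

/-- Truth of a positive formula is witnessed by finitely many elements, and is preserved by every
correspondence that is defined on these elements and preserves the relations. -/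
theorem PosForm.exists_support {L : LocalLanguage} {P : LStructure L} {α : Type}
    {σ : α → L.Sorts} (φ : PosForm L α σ) (u : (a : α) → P.Dom (σ a)) (hφ : φ.Realize P u) :
    ∃ F : List (Σ s, P.Dom s), ∀ (Q : LStructure L) (v : (a : α) → Q.Dom (σ a))
      (g : ∀ s, P.Dom s → Q.Dom s → Prop),
      (∀ e ∈ F, ∃ q, g e.1 e.2 q) →
      (∀ a, ⟨σ a, u a⟩ ∈ F → g _ (u a) (v a)) →
      (∀ s (c : L.Const s), ⟨s, P.constMap c⟩ ∈ F → g _ (P.constMap c) (Q.constMap c)) →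
      (∀ {n : ℕ} {ρ : Fin n → L.Sorts} (R : L.Rel n ρ) (x : (i : Fin n) → P.Dom (ρ i))
        (q : (i : Fin n) → Q.Dom (ρ i)), (∀ i, g _ (x i) (q i)) → P.relMap R x →
          Q.relMap R q) →
      φ.Realize Q v := by
  induction φ with
  | rel R ts =>
    refine ⟨List.ofFn fun i => ⟨_, (ts i).realize P u⟩, fun Q v g _ hv hc hR => hR R _ _ ?_ hφ⟩
    have H : ∀ {s} (t : LTerm L _ _ s),
        (⟨s, t.realize P u⟩ : Σ s, P.Dom s) ∈ List.ofFn (fun i => ⟨_, (ts i).realize P u⟩) →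
          g s (t.realize P u) (t.realize Q v) := by
      intro s t
      cases t with
      | var a => exact hv a
      | const c => exact hc _ c
    exact fun i => H (ts i) (List.mem_ofFn.2 ⟨i, rfl⟩)
  | and φ ψ ih₁ ih₂ =>
    obtain ⟨F₁, h₁⟩ := ih₁ u hφ.1
    obtain ⟨F₂, h₂⟩ := ih₂ u hφ.2
    refine ⟨F₁ ++ F₂, fun Q v g hF hv hc hR => ⟨h₁ Q v g ?_ ?_ ?_ hR, h₂ Q v g ?_ ?_ ?_ hR⟩⟩
    · exact fun e he => hF e (List.mem_append_left _ he)
    · exact fun a ha => hv a (List.mem_append_left _ ha)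
    · exact fun s c h => hc s c (List.mem_append_left _ h)
    · exact fun e he => hF e (List.mem_append_right _ he)
    · exact fun a ha => hv a (List.mem_append_right _ ha)
    · exact fun s c h => hc s c (List.mem_append_right _ h)
  | or φ ψ ih₁ ih₂ =>
    rcases hφ with hφ | hφ
    · obtain ⟨F, h⟩ := ih₁ u hφ
      exact ⟨F, fun Q v g hF hv hc hR => Or.inl (h Q v g hF hv hc hR)⟩
    · obtain ⟨F, h⟩ := ih₂ u hφ
      exact ⟨F, fun Q v g hF hv hc hR => Or.inr (h Q v g hF hv hc hR)⟩
  | ex s φ ih =>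
    obtain ⟨x, hx⟩ := hφ
    obtain ⟨F, h⟩ := ih _ hx
    refine ⟨⟨s, x⟩ :: F, fun Q v g hF hv hc hR => ?_⟩
    obtain ⟨q, hq⟩ := hF ⟨s, x⟩ List.mem_cons_self
    refine ⟨q, h Q (vcons q v) g (fun e he => hF e (List.mem_cons_of_mem _ he)) ?_
      (fun s c h => hc s c (List.mem_cons_of_mem _ h)) hR⟩
    rintro (_ | a) ha
    · exact hq
    · exact hv a (List.mem_cons_of_mem _ ha)

/-! ## Quotients by the identity relation -/

/-- The axioms of a local structure, except that the relation `dd0` is only required to be a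
congruence. -/
structure IsPreLocal {L : LocalLanguage} (A : LStructure L) : Prop where
  symm : ∀ {s : L.Sorts} (d : L.Loc s) (a b : A.Dom s), A.locRel d a b → A.locRel d b a
  mono : ∀ {s : L.Sorts} (d₁ d₂ : L.Loc s), L.locLe d₁ d₂ →
    ∀ (a b : A.Dom s), A.locRel d₁ a b → A.locRel d₂ a b
  comp : ∀ {s : L.Sorts} (d₁ d₂ : L.Loc s) (a b c : A.Dom s),
    A.locRel d₁ a b → A.locRel d₂ b c → A.locRel (L.locMul d₁ d₂) a c
  boundAx : ∀ {s : L.Sorts} (c₁ c₂ : L.Const s),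
    A.locRel (L.bound c₁ c₂) (A.constMap c₁) (A.constMap c₂)
  total : ∀ {s : L.Sorts} (a b : A.Dom s), ∃ d : L.Loc s, A.locRel d a b
  refl : ∀ {s : L.Sorts} (a : A.Dom s), A.locRel (L.dd0 s) a a
  congr : ∀ {n : ℕ} {ρ : Fin n → L.Sorts} (R : L.Rel n ρ) (x y : (i : Fin n) → A.Dom (ρ i)),
    (∀ i, A.locRel (L.dd0 (ρ i)) (x i) (y i)) → A.relMap R x → A.relMap R y

namespace IsPreLocal

variable {L : LocalLanguage} {A : LStructure L} (hA : IsPreLocal A)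

/-- The congruence `dd0`. -/
def setoid (s : L.Sorts) : Setoid (A.Dom s) where
  r a b := A.locRel (L.dd0 s) a b
  iseqv :=
    { refl := fun a => hA.refl a
      symm := fun h => hA.symm _ _ _ h
      trans := fun h₁ h₂ => by
        have := hA.comp _ _ _ _ _ h₁ h₂
        rwa [L.dd0_locMul] at this }

/-- The quotient by the congruence `dd0`. -/
def quot : LStructure L where
  Dom s := Quotient (hA.setoid s)
  relMap {_ ρ} R x := ∃ y : (i : _) → A.Dom (ρ i),
    (∀ i, Quotient.mk (hA.setoid (ρ i)) (y i) = x i) ∧ A.relMap R y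
  constMap {s} c := Quotient.mk (hA.setoid s) (A.constMap c)

/-- The class of an element. -/
def cls {s : L.Sorts} (a : A.Dom s) : hA.quot.Dom s := Quotient.mk (hA.setoid s) a

theorem cls_eq_cls {s : L.Sorts} {a b : A.Dom s} :
    hA.cls a = hA.cls b ↔ A.locRel (L.dd0 s) a b :=
  Quotient.eq (r := hA.setoid s)

theorem cls_surjective {s : L.Sorts} (q : hA.quot.Dom s) : ∃ a, hA.cls a = q :=
  Quotient.exists_rep q

theorem relMap_cls {n : ℕ} {ρ : Fin n → L.Sorts} (R : L.Rel n ρ)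
    (x : (i : Fin n) → A.Dom (ρ i)) :
    hA.quot.relMap R (fun i => hA.cls (x i)) ↔ A.relMap R x :=
  ⟨fun ⟨y, hy, h⟩ => hA.congr R y x (fun i => hA.cls_eq_cls.1 (hy i)) h,
    fun h => ⟨x, fun _ => rfl, h⟩⟩

theorem locRel_cls {s : L.Sorts} (d : L.Loc s) (a b : A.Dom s) :
    hA.quot.locRel d (hA.cls a) (hA.cls b) ↔ A.locRel d a b := by
  unfold LStructure.locRel
  rw [← hA.relMap_cls, comp_dpair (A := A.Dom) (B := hA.quot.Dom) (fun _ => hA.cls)]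

/-- The projection to the quotient. -/
def clsHom : LHom A hA.quot where
  toFun _ := hA.cls
  map_rel R x h := (hA.relMap_cls R x).2 h
  map_const _ := rfl

theorem isLocal_quot : IsLocal hA.quot where
  symm d a b := by
    obtain ⟨a, rfl⟩ := hA.cls_surjective a
    obtain ⟨b, rfl⟩ := hA.cls_surjective b
    simpa only [hA.locRel_cls] using hA.symm d a b
  mono d₁ d₂ h a b := by
    obtain ⟨a, rfl⟩ := hA.cls_surjective a
    obtain ⟨b, rfl⟩ := hA.cls_surjective b
    simpa only [hA.locRel_cls] using hA.mono d₁ d₂ h a b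
  comp d₁ d₂ a b c := by
    obtain ⟨a, rfl⟩ := hA.cls_surjective a
    obtain ⟨b, rfl⟩ := hA.cls_surjective b
    obtain ⟨c, rfl⟩ := hA.cls_surjective c
    simpa only [hA.locRel_cls] using hA.comp d₁ d₂ a b c
  boundAx c₁ c₂ := (hA.locRel_cls _ _ _).2 (hA.boundAx c₁ c₂)
  total a b := by
    obtain ⟨a, rfl⟩ := hA.cls_surjective a
    obtain ⟨b, rfl⟩ := hA.cls_surjective b
    simpa only [hA.locRel_cls] using hA.total a b
  dd0_eq a b := by
    obtain ⟨a, rfl⟩ := hA.cls_surjective a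
    obtain ⟨b, rfl⟩ := hA.cls_surjective b
    rw [hA.locRel_cls, hA.cls_eq_cls]

theorem realize_of_realize_quot {α : Type} {σ : α → L.Sorts} (φ : PosForm L α σ)
    (v : (a : α) → A.Dom (σ a)) (h : φ.Realize hA.quot (fun a => hA.cls (v a))) :
    φ.Realize A v := by
  induction φ with
  | rel R ts =>
    have e : ∀ i, (ts i).realize hA.quot (fun a => hA.cls (v a)) = hA.cls ((ts i).realize A v) :=
      fun i => (ts i).realize_hom hA.clsHom v
    simp only [PosForm.Realize, e] at h
    exact (hA.relMap_cls R _).1 h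
  | and φ ψ ih₁ ih₂ => exact ⟨ih₁ v h.1, ih₂ v h.2⟩
  | or φ ψ ih₁ ih₂ => exact h.imp (ih₁ v) (ih₂ v)
  | ex s φ ih =>
    obtain ⟨q, hq⟩ := h
    obtain ⟨x, rfl⟩ := hA.cls_surjective q
    rw [← comp_vcons (M := A) (N := hA.quot) (fun _ => hA.cls)] at hq
    exact ⟨x, ih _ hq⟩

theorem localModel_quot {T : Set (PosSentence L)} (hT : ∀ φ ∈ T, ¬ φ.RealizedIn A) :
    LocalModel hA.quot T := by
  refine ⟨hA.isLocal_quot, fun φ hφ h => hT φ hφ (hA.realize_of_realize_quot φ _ ?_)⟩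
  unfold PosSentence.RealizedIn at h
  convert h using 1

end IsPreLocal

/-! ## Bounded reduced powers -/

/-- The structure of sequences that are eventually at bounded distance from a constant sequence,
relations being interpreted as holding eventually. -/
def LStructure.boundedPower {L : LocalLanguage} (N : LStructure L) (hN : IsLocal N) {I : Type}
    (l : Filter I) : LStructure L where
  Dom s := {f : I → N.Dom s // ∃ (a : N.Dom s) (d : L.Loc s), ∀ᶠ i in l, N.locRel d (f i) a}
  relMap R x := ∀ᶠ i in l, N.relMap R (fun j => (x j).1 i)
  constMap c := ⟨fun _ => N.constMap c, N.constMap c, L.bound c c, .of_forall fun _ =>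
    hN.boundAx c c⟩

section BoundedPower

variable {L : LocalLanguage} {N : LStructure L} (hN : IsLocal N) {I : Type} (l : Filter I)

theorem boundedPower_locRel {s : L.Sorts} (d : L.Loc s) (f g : (N.boundedPower hN l).Dom s) :
    (N.boundedPower hN l).locRel d f g ↔ ∀ᶠ i in l, N.locRel d (f.1 i) (g.1 i) := by
  refine Filter.eventually_congr (.of_forall fun i => Iff.of_eq (congrArg _ ?_))
  exact comp_dpair (A := (N.boundedPower hN l).Dom) (B := N.Dom) (fun _ f => f.1 i) f g

theorem isPreLocal_boundedPower : IsPreLocal (N.boundedPower hN l) where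
  symm d f g h := by
    rw [boundedPower_locRel] at h ⊢
    exact h.mono fun i => hN.symm d _ _
  mono d₁ d₂ hd f g h := by
    rw [boundedPower_locRel] at h ⊢
    exact h.mono fun i => hN.mono d₁ d₂ hd _ _
  comp d₁ d₂ f g k h₁ h₂ := by
    rw [boundedPower_locRel] at h₁ h₂ ⊢
    exact h₁.mp (h₂.mono fun i h₂ h₁ => hN.comp d₁ d₂ _ _ _ h₁ h₂)
  boundAx c₁ c₂ := by
    rw [boundedPower_locRel]
    exact .of_forall fun _ => hN.boundAx c₁ c₂
  total f g := by
    obtain ⟨a, d, hf⟩ := f.2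
    obtain ⟨b, e, hg⟩ := g.2
    obtain ⟨k, hk⟩ := hN.total a b
    refine ⟨L.locMul (L.locMul d k) e, ?_⟩
    rw [boundedPower_locRel]
    exact hf.mp (hg.mono fun i hg hf =>
      hN.comp _ _ _ _ _ (hN.comp _ _ _ _ _ hf hk) (hN.symm _ _ _ hg))
  refl f := by
    rw [boundedPower_locRel]
    exact .of_forall fun _ => (hN.dd0_eq _ _).2 rfl
  congr R x y h hR := by
    simp only [boundedPower_locRel, hN.dd0_eq] at h
    have h' := Filter.eventually_all.2 h
    refine h'.mp (Filter.Eventually.mono hR fun i hR h => ?_)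
    rwa [← funext h]

theorem eventually_realize_of_realize_boundedPower {α : Type} {σ : α → L.Sorts}
    (φ : PosForm L α σ) (v : (a : α) → (N.boundedPower hN l).Dom (σ a))
    (h : φ.Realize (N.boundedPower hN l) v) :
    ∀ᶠ i in l, φ.Realize N (fun a => (v a).1 i) := by
  induction φ with
  | rel R ts =>
    refine Filter.Eventually.mono h fun i hi => ?_
    have e : ∀ {s} (t : LTerm L _ _ s), t.realize N (fun a => (v a).1 i) =
        (t.realize (N.boundedPower hN l) v).1 i := by
      intro s t
      cases t <;> rfl
    simp only [PosForm.Realize, e]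
    exact hi
  | and φ ψ ih₁ ih₂ => exact (ih₁ v h.1).and (ih₂ v h.2)
  | or φ ψ ih₁ ih₂ =>
    rcases h with h | h
    · exact (ih₁ v h).mono fun _ => Or.inl
    · exact (ih₂ v h).mono fun _ => Or.inr
  | ex s φ ih =>
    obtain ⟨x, hx⟩ := h
    refine (ih _ hx).mono fun i hi => ⟨x.1 i, ?_⟩
    rwa [comp_vcons (M := N.boundedPower hN l) (N := N) (fun _ f => f.1 i)] at hi

theorem localModel_quot_boundedPower [l.NeBot] {T : Set (PosSentence L)} (hT : LocalModel N T) :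
    LocalModel (isPreLocal_boundedPower hN l).quot T := by
  refine (isPreLocal_boundedPower hN l).localModel_quot fun φ hφ h => hT.2 φ hφ ?_
  obtain ⟨i, hi⟩ := (eventually_realize_of_realize_boundedPower hN l φ _ h).exists
  unfold PosSentence.RealizedIn
  convert hi using 1

/-- The diagonal homomorphism. -/
def diagHom : LHom N (isPreLocal_boundedPower hN l).quot :=
  (isPreLocal_boundedPower hN l).clsHom.comp
    { toFun := fun s a => ⟨fun _ => a, a, L.dd0 s, .of_forall fun _ => (hN.dd0_eq _ _).2 rfl⟩
      map_rel := fun _ _ h => .of_forall fun _ => h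
      map_const := fun _ => rfl }

end BoundedPower

/-! ## Amalgamating homomorphisms over local positive types -/

/-- Atomic formulas. -/
structure LAtom (L : LocalLanguage) (α : Type) (σ : α → L.Sorts) : Type where
  n : ℕ
  ρ : Fin n → L.Sorts
  R : L.Rel n ρ
  ts : (i : Fin n) → LTerm L α σ (ρ i)

def LAtom.Realize {L : LocalLanguage} (M : LStructure L) {α : Type} {σ : α → L.Sorts}
    (A : LAtom L α σ) (v : (a : α) → M.Dom (σ a)) : Prop :=
  M.relMap A.R (fun i => (A.ts i).realize M v)

/-- The atomic formula `d(t₁, t₂)`. -/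
def LAtom.loc {L : LocalLanguage} {α : Type} {σ : α → L.Sorts} {s : L.Sorts} (d : L.Loc s)
    (t₁ t₂ : LTerm L α σ s) : LAtom L α σ :=
  ⟨2, ![s, s], L.locToRel d, tpair t₁ t₂⟩

theorem LAtom.realize_loc {L : LocalLanguage} {M : LStructure L} {α : Type} {σ : α → L.Sorts}
    {s : L.Sorts} (d : L.Loc s) (t₁ t₂ : LTerm L α σ s) (v : (a : α) → M.Dom (σ a)) :
    (LAtom.loc d t₁ t₂).Realize M v ↔ M.locRel d (t₁.realize M v) (t₂.realize M v) :=
  PosForm.realize_locRel d t₁ t₂ v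

theorem realize_foldr_and {L : LocalLanguage} {M : LStructure L} {α : Type} {σ : α → L.Sorts}
    (ψ : LPosForm L α σ) (Φ : List (LPosForm L α σ)) (v : (a : α) → M.Dom (σ a)) :
    (Φ.foldr LPosForm.and ψ).Realize M v ↔ (∀ φ ∈ Φ, φ.Realize M v) ∧ ψ.Realize M v := by
  induction Φ with
  | nil => simp
  | cons φ Φ ih =>
    simp only [List.foldr_cons, LPosForm.Realize, ih, List.forall_mem_cons, and_assoc]

theorem LPosForm.realize_locRel {L : LocalLanguage} {M : LStructure L} {α : Type}
    {σ : α → L.Sorts} {s : L.Sorts} (d : L.Loc s) (t₁ t₂ : LTerm L α σ s)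
    (v : (a : α) → M.Dom (σ a)) :
    (LPosForm.rel (L.locToRel d) (tpair t₁ t₂)).Realize M v ↔
      M.locRel d (t₁.realize M v) (t₂.realize M v) :=
  PosForm.realize_locRel d t₁ t₂ v

section Amalgamation

variable {L : LocalLanguage} {M N : LStructure L} {α : Type} {σ : α → L.Sorts}
  {v : (a : α) → M.Dom (σ a)} {w : (a : α) → N.Dom (σ a)}

/-- Finitely many elements of `M` can be added, by local existential quantification, to the
context of a tuple whose local positive type is contained in that of `w`. -/
theorem exists_context (hM : IsLocal M) (h : ltp M v ⊆ ltp N w)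
    (ref : ∀ s, LTerm L α σ s) (l : List (Σ s, M.Dom s)) :
    ∃ (β : Type) (τ : β → L.Sorts) (v' : (b : β) → M.Dom (τ b))
      (base : (a : α) → LTerm L β τ (σ a)) (idx : ∀ s, M.Dom s → LTerm L β τ s),
      (∀ a, (base a).realize M v' = v a) ∧
      (∀ e ∈ l, (idx e.1 e.2).realize M v' = e.2) ∧
      ∀ Φ : List (LPosForm L β τ), (∀ φ ∈ Φ, φ.Realize M v') →
        ∃ w' : (b : β) → N.Dom (τ b), (∀ a, (base a).realize N w' = w a) ∧
          ∀ φ ∈ Φ, φ.Realize N w' := by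
  induction l with
  | nil =>
    exact ⟨α, σ, v, fun a => .var a, fun s _ => ref s, fun _ => rfl, by simp,
      fun Φ hΦ => ⟨w, fun _ => rfl, fun φ hφ => h (hΦ φ hφ)⟩⟩
  | cons e l ih =>
    classical
    obtain ⟨s, m⟩ := e
    obtain ⟨β, τ, v', base, idx, hbase, hidx, H⟩ := ih
    refine ⟨Option β, osort s τ, vcons m v', fun a => (base a).lift s, fun s' m' =>
      if hs : ∃ hs : s = s', hs ▸ m = m' then hs.1 ▸ .var (σ := osort s τ) none
      else (idx s' m').lift s, ?_, ?_, ?_⟩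
    · intro a
      rw [LTerm.realize_lift, hbase]
    · rintro ⟨s', m'⟩ he
      dsimp only
      split_ifs with hs
      · obtain ⟨rfl, rfl⟩ := hs
        rfl
      · rw [LTerm.realize_lift]
        refine hidx _ ((List.mem_cons.1 he).resolve_left ?_)
        rintro ⟨⟩
        exact hs ⟨rfl, rfl⟩
    · intro Φ hΦ
      let t : LTerm L β τ s := (ref s).subst base
      obtain ⟨d, hd⟩ := hM.total m (t.realize M v')
      let ψ : LPosForm L (Option β) (osort s τ) :=
        .rel (L.locToRel d) (tpair (.var (σ := osort s τ) none) (t.lift s))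
      obtain ⟨w', hw, hw'⟩ := H [.lex s d t (Φ.foldr .and ψ)] <| by
        simp only [List.mem_singleton, forall_eq]
        refine ⟨m, hd, (realize_foldr_and _ _ _).2 ⟨hΦ, (LPosForm.realize_locRel _ _ _ _).2 ?_⟩⟩
        rw [LTerm.realize_lift]
        exact hd
      obtain ⟨x, -, hx⟩ := hw' _ (List.mem_singleton_self _)
      refine ⟨vcons x w', fun a => ?_, ((realize_foldr_and _ _ _).1 hx).1⟩
      rw [LTerm.realize_lift, hw]

/-- The elements of `M` occurring in a term with parameters. -/
def LTerm.params : {s : L.Sorts} →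
    LTerm L (α ⊕ Σ s, M.Dom s) (Sum.elim σ (fun p => p.1)) s → List (Σ s, M.Dom s)
  | _, .var (.inr e) => [e]
  | _, _ => []

/-- The canonical assignment to a context extended by the elements of `M` themselves. -/
abbrev withElems (w : (a : α) → N.Dom (σ a)) (f : ∀ s, M.Dom s → N.Dom s) :
    (x : α ⊕ Σ s, M.Dom s) → N.Dom (Sum.elim σ (fun p => p.1) x) :=
  sval w (fun p => f p.1 p.2)

theorem exists_realize_atoms (hM : IsLocal M) (h : ltp M v ⊆ ltp N w)
    (ref : ∀ s, LTerm L α σ s)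
    (Φ : List (LAtom L (α ⊕ Σ s, M.Dom s) (Sum.elim σ (fun p => p.1))))
    (hΦ : ∀ A ∈ Φ, A.Realize M (withElems v fun _ m => m)) :
    ∃ f : ∀ s, M.Dom s → N.Dom s, ∀ A ∈ Φ, A.Realize N (withElems w f) := by
  obtain ⟨β, τ, v', base, idx, hbase, hidx, H⟩ := exists_context hM h ref
    (Φ.flatMap fun A => (List.ofFn fun i => (A.ts i).params).flatten)
  let g : (x : α ⊕ Σ s, M.Dom s) → LTerm L β τ (Sum.elim σ (fun p => p.1) x)
    | .inl a => base a
    | .inr e => idx e.1 e.2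
  obtain ⟨w', hw, hw'⟩ := H (Φ.map fun A => .rel A.R fun i => (A.ts i).subst g) <| by
    intro φ hφ
    obtain ⟨A, hA, rfl⟩ := List.mem_map.1 hφ
    have ht : ∀ {s} (t : LTerm L (α ⊕ Σ s, M.Dom s) (Sum.elim σ (fun p => p.1)) s),
        (∀ e ∈ t.params, (idx e.1 e.2).realize M v' = e.2) →
        (t.subst g).realize M v' = t.realize M (withElems v fun _ m => m) := by
      intro s t hi
      cases t with
      | const c => rfl
      | var x =>
        rcases x with a | e
        · exact hbase a
        · exact hi e (List.mem_singleton_self e)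
    have e : ∀ i, ((A.ts i).subst g).realize M v' =
        (A.ts i).realize M (withElems v fun _ m => m) := fun i =>
      ht _ fun e he => hidx e (List.mem_flatMap.2 ⟨A, hA, List.mem_flatten.2
        ⟨_, List.mem_ofFn.2 ⟨i, rfl⟩, he⟩⟩)
    simp only [LPosForm.Realize, e]
    exact hΦ A hA
  refine ⟨fun s m => (idx s m).realize N w', fun A hA => ?_⟩
  have hAB := hw' _ (List.mem_map.2 ⟨A, hA, rfl⟩)
  simp only [LPosForm.Realize, LTerm.realize_subst] at hAB
  have e : (fun x => (g x).realize N w') =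
      withElems w (fun s m => (idx s m).realize N w') := by
    funext x
    rcases x with a | e
    · exact hw a
    · rfl
  rw [e] at hAB
  exact hAB

/-- If the local positive type of `v` is contained in that of `w`, a pointed tuple, then there is
a homomorphism mapping `v` to `w` from `M` to an extension of `N`. -/
theorem exists_amalgam (hpt : VPointed σ) {T : Set (PosSentence L)} (hM : IsLocal M)
    (hN : LocalModel N T) (h : ltp M v ⊆ ltp N w) :
    ∃ (P : LStructure L) (f : LHom M P) (g : LHom N P), LocalModel P T ∧
      ∀ a, f.toFun _ (v a) = g.toFun _ (w a) := by
  classical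
  have hne : ∀ s, Nonempty (LTerm L α σ s) := by
    intro s
    by_cases hs : s ∈ Set.range σ
    · obtain ⟨a, rfl⟩ := hs
      exact ⟨.var a⟩
    · exact (hpt s hs).map .const
  let ref : ∀ s, LTerm L α σ s := fun s => (hne s).some
  let Req := {A : LAtom L (α ⊕ Σ s, M.Dom s) (Sum.elim σ (fun p => p.1)) //
    A.Realize M (withElems v fun _ m => m)}
  have H : ∀ i : Finset Req, ∃ f : ∀ s, M.Dom s → N.Dom s,
      ∀ A ∈ i, A.1.Realize N (withElems w f) := by
    intro i
    obtain ⟨f, hf⟩ := exists_realize_atoms hM h ref (i.toList.map Subtype.val) <| by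
      intro A hA
      obtain ⟨A, -, rfl⟩ := List.mem_map.1 hA
      exact A.2
    exact ⟨f, fun A hA => hf _ (List.mem_map_of_mem (Finset.mem_toList.2 hA))⟩
  choose f hf using H
  have hev : ∀ A : LAtom L (α ⊕ Σ s, M.Dom s) (Sum.elim σ (fun p => p.1)),
      A.Realize M (withElems v fun _ m => m) →
      ∀ᶠ i in Filter.atTop, A.Realize N (withElems w (f i)) := fun A hA =>
    (Filter.eventually_ge_atTop ({⟨A, hA⟩} : Finset Req)).mono fun i hi =>
      hf i ⟨A, hA⟩ (hi (Finset.mem_singleton_self _))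
  let l : Filter (Finset Req) := Filter.atTop
  have hpre := isPreLocal_boundedPower hN.1 l
  let el {s : L.Sorts} (m : M.Dom s) :
      LTerm L (α ⊕ Σ s, M.Dom s) (Sum.elim σ (fun p => p.1)) s :=
    .var (σ := Sum.elim σ (fun p : Σ s, M.Dom s => p.1)) (.inr ⟨s, m⟩)
  let old (a : α) : LTerm L (α ⊕ Σ s, M.Dom s) (Sum.elim σ (fun p => p.1)) (σ a) :=
    .var (σ := Sum.elim σ (fun p : Σ s, M.Dom s => p.1)) (.inl a)
  have hdd : ∀ {s : L.Sorts} (t₁ t₂ : LTerm L (α ⊕ Σ s, M.Dom s) (Sum.elim σ (fun p => p.1)) s),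
      t₁.realize M (withElems v fun _ m => m) = t₂.realize M (withElems v fun _ m => m) →
      ∀ᶠ i in l, N.locRel (L.dd0 s) (t₁.realize N (withElems w (f i)))
        (t₂.realize N (withElems w (f i))) := fun t₁ t₂ ht =>
    (hev (.loc (L.dd0 _) t₁ t₂) ((LAtom.realize_loc _ _ _ _).2 ((hM.dd0_eq _ _).2 ht))).mono
      fun i hi => (LAtom.realize_loc _ _ _ _).1 hi
  have hbd : ∀ (s : L.Sorts) (m : M.Dom s), ∃ (a : N.Dom s) (d : L.Loc s),
      ∀ᶠ i in l, N.locRel d (f i s m) a := by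
    intro s m
    obtain ⟨d, hd⟩ := hM.total m (((ref s).subst old).realize M (withElems v fun _ m => m))
    refine ⟨(ref s).realize N w, d, (hev (.loc d (el m) ((ref s).subst old))
      ((LAtom.realize_loc _ _ _ _).2 hd)).mono fun i hi => ?_⟩
    have := (LAtom.realize_loc _ _ _ _).1 hi
    rw [LTerm.realize_subst] at this
    exact this
  refine ⟨hpre.quot,
    { toFun := fun s m => hpre.cls ⟨fun i => f i s m, hbd s m⟩
      map_rel := fun {n ρ} R x hx =>
        (hpre.relMap_cls R _).2 (hev ⟨n, ρ, R, fun i => el (x i)⟩ hx)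
      map_const := fun c => hpre.cls_eq_cls.2 ((boundedPower_locRel hN.1 l _ _ _).2
        (hdd (el (M.constMap c)) (.const c) rfl)) },
    diagHom hN.1 l, localModel_quot_boundedPower hN.1 l hN, fun a => ?_⟩
  exact hpre.cls_eq_cls.2 ((boundedPower_locRel hN.1 l _ _ _).2 (hdd (el (v a)) (old a) rfl))

/-- The local positive type of a pointed tuple in a local positively closed model is maximal. -/
theorem IsPC.isLType_ltp {T : Set (PosSentence L)} (hM : IsPC M T) (hpt : VPointed σ)
    (v : (a : α) → M.Dom (σ a)) : IsLType T (ltp M v) := by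
  refine ⟨⟨M, v, hM.1, fun _ => id⟩, fun Γ ⟨N, w, hN, hw⟩ hΓ => (hΓ.antisymm ?_).symm⟩
  obtain ⟨P, f, g, hP, hfg⟩ := exists_amalgam hpt hM.1.1 hN fun φ hφ => hw φ (hΓ hφ)
  intro φ hφ
  refine (φ.realize_toPos v).1 (hM.2 P f hP _ _ _ _ ((φ.realize_toPos _).2 ?_))
  rw [funext hfg]
  exact (hw φ hφ).map g

end Amalgamation

/-! ## Existence of local positively closed models -/

/-- The shape of a tuple of existential witnesses: its length and sorts, the set of positions
whose values are prescribed, and the atomic relations that have to hold. -/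
structure WitShape (L : LocalLanguage) : Type where
  k : ℕ
  τ : Fin k → L.Sorts
  pin : Fin k → Prop
  atoms : {n : ℕ} → (idx : Fin n → Fin k) → L.Rel n (fun i => τ (idx i)) → Prop

/-- Names for the elements of `M` and for iterated existential witnesses. -/
inductive HTerm {L : LocalLanguage} (M : LStructure L) : L.Sorts → Type
  | base {s : L.Sorts} (m : M.Dom s) : HTerm M s
  | wit (θ : WitShape L) (params : (j : Fin θ.k) → θ.pin j → HTerm M (θ.τ j)) (j : Fin θ.k) :
      HTerm M (θ.τ j)

/-- A shape of witnesses together with the prescribed values. -/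
structure WitData {L : LocalLanguage} (M : LStructure L) : Type where
  θ : WitShape L
  params : (j : Fin θ.k) → θ.pin j → HTerm M (θ.τ j)

/-- The witnesses named by given data. -/
def WitData.wit {L : LocalLanguage} {M : LStructure L} (d : WitData M) (j : Fin d.θ.k) :
    HTerm M (d.θ.τ j) :=
  .wit d.θ d.params j

/-- The data of a witness. -/
def HTerm.data {L : LocalLanguage} {M : LStructure L} :
    {s : L.Sorts} → HTerm M s → Option (WitData M)
  | _, .base _ => none
  | _, .wit θ params _ => some ⟨θ, params⟩

/-- The position of a witness in its tuple. -/
def HTerm.pos {L : LocalLanguage} {M : LStructure L} : {s : L.Sorts} → HTerm M s → ℕ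
  | _, .base _ => 0
  | _, .wit _ _ j => j

/-- Systems of relations on the names. -/
abbrev HRel {L : LocalLanguage} (M : LStructure L) : Type :=
  (n : ℕ) → (ρ : Fin n → L.Sorts) → L.Rel n ρ → ((i : Fin n) → HTerm M (ρ i)) → Prop

namespace HRel

variable {L : LocalLanguage} {M : LStructure L} {T : Set (PosSentence L)}

def loc (Z : HRel M) {s : L.Sorts} (d : L.Loc s) (x y : HTerm M s) : Prop :=
  Z 2 ![s, s] (L.locToRel d) (dpair x y)

/-- The names that are in use. -/
def supp (Z : HRel M) {s : L.Sorts} (x : HTerm M s) : Prop :=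
  Z.loc (L.dd0 s) x x

/-- The names in use form a structure that is local up to the congruence `dd0`. -/
structure IsPre (Z : HRel M) : Prop where
  supp_of_rel : ∀ {n : ℕ} {ρ : Fin n → L.Sorts} (R : L.Rel n ρ) (x : (i : Fin n) → HTerm M (ρ i)),
    Z n ρ R x → ∀ i, Z.supp (x i)
  base : ∀ {n : ℕ} {ρ : Fin n → L.Sorts} (R : L.Rel n ρ) (x : (i : Fin n) → M.Dom (ρ i)),
    M.relMap R x → Z n ρ R (fun i => .base (x i))
  symm : ∀ {s : L.Sorts} (d : L.Loc s) (x y : HTerm M s), Z.loc d x y → Z.loc d y x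
  mono : ∀ {s : L.Sorts} (d₁ d₂ : L.Loc s), L.locLe d₁ d₂ →
    ∀ (x y : HTerm M s), Z.loc d₁ x y → Z.loc d₂ x y
  comp : ∀ {s : L.Sorts} (d₁ d₂ : L.Loc s) (x y z : HTerm M s),
    Z.loc d₁ x y → Z.loc d₂ y z → Z.loc (L.locMul d₁ d₂) x z
  total : ∀ {s : L.Sorts} (x y : HTerm M s), Z.supp x → Z.supp y → ∃ d : L.Loc s, Z.loc d x y
  congr : ∀ {n : ℕ} {ρ : Fin n → L.Sorts} (R : L.Rel n ρ) (x y : (i : Fin n) → HTerm M (ρ i)),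
    (∀ i, Z.loc (L.dd0 (ρ i)) (x i) (y i)) → Z n ρ R x → Z n ρ R y

theorem IsPre.base_loc {Z : HRel M} (hZ : Z.IsPre) {s : L.Sorts} {d : L.Loc s} {a b : M.Dom s}
    (h : M.locRel d a b) : Z.loc d (.base a) (.base b) := by
  have := hZ.base _ _ h
  rwa [comp_dpair (A := M.Dom) (B := HTerm M) (fun _ => .base)] at this

/-- The structure on the names in use. -/
def str (hM : IsLocal M) (Z : HRel M) (hZ : Z.IsPre) : LStructure L where
  Dom s := {x : HTerm M s // Z.supp x}
  relMap {n ρ} R x := Z n ρ R (fun i => (x i).1)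
  constMap c := ⟨.base (M.constMap c), hZ.base_loc ((hM.dd0_eq _ _).2 rfl)⟩

theorem str_locRel (hM : IsLocal M) {Z : HRel M} (hZ : Z.IsPre) {s : L.Sorts} (d : L.Loc s)
    (x y : (Z.str hM hZ).Dom s) : (Z.str hM hZ).locRel d x y ↔ Z.loc d x.1 y.1 :=
  Iff.of_eq (congrArg (Z 2 ![s, s] (L.locToRel d))
    (comp_dpair (A := (Z.str hM hZ).Dom) (B := HTerm M) (fun _ x => x.1) x y))

theorem isPreLocal_str (hM : IsLocal M) {Z : HRel M} (hZ : Z.IsPre) :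
    IsPreLocal (Z.str hM hZ) where
  symm d x y := by
    simpa only [str_locRel] using hZ.symm d _ _
  mono d₁ d₂ h x y := by
    simpa only [str_locRel] using hZ.mono d₁ d₂ h _ _
  comp d₁ d₂ x y z := by
    simpa only [str_locRel] using hZ.comp d₁ d₂ _ _ _
  boundAx c₁ c₂ := (str_locRel _ _ _ _ _).2 (hZ.base_loc (hM.boundAx c₁ c₂))
  total x y := by
    simpa only [str_locRel] using hZ.total _ _ x.2 y.2
  refl x := (str_locRel _ _ _ _ _).2 x.2
  congr R x y h := by
    simp only [str_locRel] at h
    exact hZ.congr R _ _ h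

/-- The homomorphism induced by an inclusion of systems of relations. -/
def inclHom (hM : IsLocal M) {Z Z' : HRel M} (hZ : Z.IsPre) (hZ' : Z'.IsPre) (h : Z ≤ Z') :
    LHom (Z.str hM hZ) (Z'.str hM hZ') where
  toFun _ x := ⟨x.1, h _ _ _ _ x.2⟩
  map_rel R _ hx := h _ _ R _ hx
  map_const _ := rfl

/-- The witnesses with data `d` are in use and are indeed witnesses. -/
structure Witnesses (Z : HRel M) (d : WitData M) : Prop where
  supp : ∀ j, Z.supp (d.wit j)
  pin : ∀ j hj, Z.loc (L.dd0 _) (d.wit j) (d.params j hj)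
  atoms : ∀ {n : ℕ} (idx : Fin n → Fin d.θ.k) (R : L.Rel n (fun i => d.θ.τ (idx i))),
    d.θ.atoms idx R → Z n _ R (fun i => d.wit (idx i))

theorem Witnesses.mono {Z Z' : HRel M} (h : Z ≤ Z') {d : WitData M} (hd : Z.Witnesses d) :
    Z'.Witnesses d where
  supp j := h _ _ _ _ (hd.supp j)
  pin j hj := h _ _ _ _ (hd.pin j hj)
  atoms idx R hR := h _ _ _ _ (hd.atoms idx R hR)

/-- The names in use present a local model of `T`, and all witnesses in use are witnesses. -/
structure IsGood (hM : IsLocal M) (T : Set (PosSentence L)) (Z : HRel M) : Prop where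
  isPre : Z.IsPre
  neg : ∀ φ ∈ T, ¬ φ.RealizedIn (Z.str hM isPre)
  henkin : ∀ {s : L.Sorts} (x : HTerm M s) (d : WitData M), Z.supp x → x.data = some d →
    Z.Witnesses d

/-! ### Unions of chains -/

section Chain

variable {c : Set (HRel M)}

/-- The union of a set of systems of relations. -/
def union (c : Set (HRel M)) : HRel M := fun n ρ R x => ∃ Z ∈ c, Z n ρ R x

theorem le_union {Z : HRel M} (hZ : Z ∈ c) : Z ≤ union c := fun _ _ _ _ h => ⟨Z, hZ, h⟩

theorem exists_common (hc : IsChain (· ≤ ·) c) (hne : c.Nonempty) {ι : Type} [Finite ι]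
    (f : ι → HRel M) (hf : ∀ i, f i ∈ c) : ∃ Z ∈ c, ∀ i, f i ≤ Z := by
  have := hne.to_subtype
  have : IsDirectedOrder c := ⟨fun a b => by
    obtain ⟨z, hz, h⟩ := hc.directedOn a.1 a.2 b.1 b.2
    exact ⟨⟨z, hz⟩, h⟩⟩
  obtain ⟨Z, hZ⟩ := Finite.exists_le (fun i => (⟨f i, hf i⟩ : c))
  exact ⟨Z.1, Z.2, hZ⟩

theorem exists_common₂ (hc : IsChain (· ≤ ·) c) {Z₁ Z₂ : HRel M} (h₁ : Z₁ ∈ c) (h₂ : Z₂ ∈ c) :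
    ∃ Z ∈ c, Z₁ ≤ Z ∧ Z₂ ≤ Z :=
  hc.directedOn Z₁ h₁ Z₂ h₂

theorem isPre_union (hc : IsChain (· ≤ ·) c) (hne : c.Nonempty) (h : ∀ Z ∈ c, Z.IsPre) :
    (union c).IsPre where
  supp_of_rel R x := fun ⟨Z, hZ, hR⟩ i => ⟨Z, hZ, (h Z hZ).supp_of_rel R x hR i⟩
  base R x hR := by
    obtain ⟨Z, hZ⟩ := hne
    exact ⟨Z, hZ, (h Z hZ).base R x hR⟩
  symm d x y := fun ⟨Z, hZ, hd⟩ => ⟨Z, hZ, (h Z hZ).symm d x y hd⟩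
  mono d₁ d₂ hd x y := fun ⟨Z, hZ, hd₁⟩ => ⟨Z, hZ, (h Z hZ).mono d₁ d₂ hd x y hd₁⟩
  comp d₁ d₂ x y z := fun ⟨Z₁, hZ₁, hd₁⟩ ⟨Z₂, hZ₂, hd₂⟩ => by
    obtain ⟨Z, hZ, hle₁, hle₂⟩ := exists_common₂ hc hZ₁ hZ₂
    exact ⟨Z, hZ, (h Z hZ).comp d₁ d₂ x y z (hle₁ _ _ _ _ hd₁) (hle₂ _ _ _ _ hd₂)⟩
  total x y := fun ⟨Z₁, hZ₁, hx⟩ ⟨Z₂, hZ₂, hy⟩ => by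
    obtain ⟨Z, hZ, hle₁, hle₂⟩ := exists_common₂ hc hZ₁ hZ₂
    obtain ⟨d, hd⟩ := (h Z hZ).total x y (hle₁ _ _ _ _ hx) (hle₂ _ _ _ _ hy)
    exact ⟨d, Z, hZ, hd⟩
  congr R x y hxy := fun ⟨Z₁, hZ₁, hR⟩ => by
    choose f hf hf' using hxy
    obtain ⟨Z₂, hZ₂, hle⟩ := exists_common hc hne f hf
    obtain ⟨Z, hZ, hle₁, hle₂⟩ := exists_common₂ hc hZ₁ hZ₂
    exact ⟨Z, hZ, (h Z hZ).congr R x y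
      (fun i => hle₂ _ _ _ _ (hle i _ _ _ _ (hf' i))) (hle₁ _ _ _ _ hR)⟩

theorem exists_realize_of_realize_union (hM : IsLocal M) (hc : IsChain (· ≤ ·) c)
    (hne : c.Nonempty) (h : ∀ Z ∈ c, Z.IsPre) {α : Type} {σ : α → L.Sorts} (φ : PosForm L α σ)
    (v : (a : α) → ((union c).str hM (isPre_union hc hne h)).Dom (σ a)) (Z₀ : HRel M)
    (hZ₀ : Z₀ ∈ c) (hv : ∀ a, Z₀.supp (v a).1)
    (hφ : φ.Realize ((union c).str hM (isPre_union hc hne h)) v) :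
    ∃ (Z : HRel M) (hZ : Z ∈ c) (hv' : ∀ a, Z.supp (v a).1), Z₀ ≤ Z ∧
      φ.Realize (Z.str hM (h Z hZ)) (fun a => ⟨(v a).1, hv' a⟩) := by
  induction φ generalizing Z₀ with
  | rel R ts =>
    obtain ⟨Z₁, hZ₁, hR⟩ := hφ
    obtain ⟨Z, hZ, hle₀, hle₁⟩ := exists_common₂ hc hZ₀ hZ₁
    have hv' := fun a => hle₀ _ _ _ _ (hv a)
    refine ⟨Z, hZ, hv', hle₀, ?_⟩
    have e : ∀ {s} (t : LTerm L _ _ s),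
        (t.realize (Z.str hM (h Z hZ)) (fun a => ⟨(v a).1, hv' a⟩)).1 =
          (t.realize ((union c).str hM (isPre_union hc hne h)) v).1 := by
      intro s t
      cases t <;> rfl
    have := hle₁ _ _ _ _ hR
    simp only [← e] at this
    exact this
  | and φ ψ ih₁ ih₂ =>
    obtain ⟨Z₁, hZ₁, hv₁, hle₁, h₁⟩ := ih₁ v Z₀ hZ₀ hv hφ.1
    obtain ⟨Z₂, hZ₂, hv₂, hle₂, h₂⟩ := ih₂ v Z₁ hZ₁ hv₁ hφ.2
    exact ⟨Z₂, hZ₂, hv₂, hle₁.trans hle₂, h₁.map (inclHom hM _ _ hle₂), h₂⟩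
  | or φ ψ ih₁ ih₂ =>
    rcases hφ with hφ | hφ
    · obtain ⟨Z, hZ, hv', hle, h'⟩ := ih₁ v Z₀ hZ₀ hv hφ
      exact ⟨Z, hZ, hv', hle, Or.inl h'⟩
    · obtain ⟨Z, hZ, hv', hle, h'⟩ := ih₂ v Z₀ hZ₀ hv hφ
      exact ⟨Z, hZ, hv', hle, Or.inr h'⟩
  | ex s φ ih =>
    obtain ⟨x, hx⟩ := hφ
    obtain ⟨Z₁, hZ₁, hx₁⟩ := x.2
    obtain ⟨Z₂, hZ₂, hle₀, hle₁⟩ := exists_common₂ hc hZ₀ hZ₁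
    obtain ⟨Z, hZ, hv', hle, h'⟩ := ih (vcons x v) Z₂ hZ₂ (by
      rintro (_ | a)
      · exact hle₁ _ _ _ _ hx₁
      · exact hle₀ _ _ _ _ (hv a)) hx
    refine ⟨Z, hZ, fun a => hv' (some a), hle₀.trans hle, ⟨x.1, hv' none⟩, ?_⟩
    refine Eq.mp (congrArg (φ.Realize (Z.str hM (h Z hZ))) (funext fun o => ?_)) h'
    cases o <;> rfl

theorem isGood_union (hM : IsLocal M) (hc : IsChain (· ≤ ·) c) (hne : c.Nonempty)
    (h : ∀ Z ∈ c, Z.IsGood hM T) : (union c).IsGood hM T where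
  isPre := isPre_union hc hne fun Z hZ => (h Z hZ).isPre
  neg φ hφ hr := by
    obtain ⟨Z₀, hZ₀⟩ := hne
    obtain ⟨Z, hZ, _, _, h'⟩ := exists_realize_of_realize_union hM hc ⟨Z₀, hZ₀⟩
      (fun Z hZ => (h Z hZ).isPre) φ _ Z₀ hZ₀ (fun a => a.elim) hr
    exact (h Z hZ).neg φ hφ (Eq.mp (congrArg (φ.Realize _) (funext fun a => a.elim)) h')
  henkin x d := fun ⟨Z, hZ, hx⟩ hd => ((h Z hZ).henkin x d hx hd).mono (le_union hZ)

end Chain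

/-! ### Systems of relations pulled back from a model -/

section Pull

variable {P : LStructure L} {e : ∀ s, HTerm M s → P.Dom s → Prop}

/-- The relations that hold in `P` under the partial interpretation `e` of the names. -/
def pull (P : LStructure L) (e : ∀ s, HTerm M s → P.Dom s → Prop) : HRel M :=
  fun _ ρ R x => ∃ y : (i : _) → P.Dom (ρ i), (∀ i, e _ (x i) (y i)) ∧ P.relMap R y

theorem pull_loc {s : L.Sorts} (d : L.Loc s) (x y : HTerm M s) :
    (pull P e).loc d x y ↔ ∃ a b, e s x a ∧ e s y b ∧ P.locRel d a b := by
  constructor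
  · rintro ⟨z, hz, hR⟩
    refine ⟨z 0, z 1, hz 0, hz 1, ?_⟩
    unfold LStructure.locRel
    convert hR using 1
    funext i
    match i with
    | ⟨0, _⟩ => rfl
    | ⟨1, _⟩ => rfl
  · rintro ⟨a, b, ha, hb, hd⟩
    refine ⟨_, fun i => ?_, hd⟩
    match i with
    | ⟨0, _⟩ => exact ha
    | ⟨1, _⟩ => exact hb

theorem pull_supp (hP : IsLocal P) {s : L.Sorts} (x : HTerm M s) :
    (pull P e).supp x ↔ ∃ a, e s x a :=
  (pull_loc _ _ _).trans ⟨fun ⟨a, _, ha, _⟩ => ⟨a, ha⟩,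
    fun ⟨a, ha⟩ => ⟨a, a, ha, ha, (hP.dd0_eq _ _).2 rfl⟩⟩

theorem isPre_pull (hP : IsLocal P) (he : ∀ s x y y', e s x y → e s x y' → y = y')
    (f : LHom M P) (hf : ∀ s (m : M.Dom s), e s (.base m) (f.toFun s m)) :
    (pull P e).IsPre where
  supp_of_rel R x := fun ⟨y, hy, _⟩ i => (pull_supp hP _).2 ⟨y i, hy i⟩
  base R x hR := ⟨_, fun i => hf _ (x i), f.map_rel R x hR⟩
  symm d x y := by
    simp only [pull_loc]
    rintro ⟨a, b, ha, hb, hd⟩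
    exact ⟨b, a, hb, ha, hP.symm _ _ _ hd⟩
  mono d₁ d₂ h x y := by
    simp only [pull_loc]
    rintro ⟨a, b, ha, hb, hd⟩
    exact ⟨a, b, ha, hb, hP.mono _ _ h _ _ hd⟩
  comp d₁ d₂ x y z := by
    simp only [pull_loc]
    rintro ⟨a, b, ha, hb, hd⟩ ⟨b', c, hb', hc, hd'⟩
    obtain rfl := he _ _ _ _ hb hb'
    exact ⟨a, c, ha, hc, hP.comp _ _ _ _ _ hd hd'⟩
  total x y := by
    simp only [pull_supp hP, pull_loc]
    rintro ⟨a, ha⟩ ⟨b, hb⟩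
    obtain ⟨d, hd⟩ := hP.total a b
    exact ⟨d, a, b, ha, hb, hd⟩
  congr R x y hxy := by
    simp only [pull_loc, hP.dd0_eq] at hxy
    rintro ⟨z, hz, hR⟩
    refine ⟨z, fun i => ?_, hR⟩
    obtain ⟨a, _, ha, hb, rfl⟩ := hxy i
    rwa [he _ _ _ _ (hz i) ha]

theorem isGood_pull (hM : IsLocal M) (hP : LocalModel P T)
    (he : ∀ s x y y', e s x y → e s x y' → y = y')
    (f : LHom M P) (hf : ∀ s (m : M.Dom s), e s (.base m) (f.toFun s m))
    (hw : ∀ s x y (d : WitData M), e s x y → x.data = some d →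
      ∃ b : (j : _) → P.Dom (d.θ.τ j), (∀ j, e _ (d.wit j) (b j)) ∧
        (∀ j hj, e _ (d.params j hj) (b j)) ∧
        ∀ {n : ℕ} (idx : Fin n → Fin d.θ.k) (R : L.Rel n (fun i => d.θ.τ (idx i))),
          d.θ.atoms idx R → P.relMap R (fun i => b (idx i))) :
    (pull P e).IsGood hM T where
  isPre := isPre_pull hP.1 he f hf
  neg φ hφ hr := by
    have H : ∀ s (x : ((pull P e).str hM (isPre_pull hP.1 he f hf)).Dom s), ∃ a, e s x.1 a :=
      fun s x => (pull_supp hP.1 _).1 x.2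
    choose g hg using H
    let g' : LHom ((pull P e).str hM (isPre_pull hP.1 he f hf)) P :=
      { toFun := g
        map_rel := fun R x ⟨y, hy, hR⟩ => by
          rwa [funext fun i => he _ _ _ _ (hg _ (x i)) (hy i)]
        map_const := fun c => by
          rw [← f.map_const]
          exact he _ _ _ _ (hg _ _) (hf _ _) }
    exact hP.2 φ hφ (hr.map g')
  henkin x d hx hd := by
    obtain ⟨a, ha⟩ := (pull_supp hP.1 _).1 hx
    obtain ⟨b, hb, hb', hR⟩ := hw _ _ _ _ ha hd
    exact
      { supp := fun j => (pull_supp hP.1 _).2 ⟨_, hb j⟩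
        pin := fun j hj => (pull_loc _ _ _).2
          ⟨_, _, hb j, hb' j hj, (hP.1.dd0_eq _ _).2 rfl⟩
        atoms := fun idx R h => ⟨_, fun i => hb (idx i), hR idx R h⟩ }

theorem exists_isGood (hM : LocalModel M T) : ∃ Z : HRel M, Z.IsGood hM.1 T := by
  refine ⟨_, isGood_pull (P := M) (e := fun s x m => x = .base m) hM.1 hM ?_ (LHom.id M)
    (fun _ _ => rfl) ?_⟩
  · rintro s x y y' rfl h
    injection h
  · rintro s x y d rfl h
    cases h

end Pull

/-! ### Maximal systems of relations -/

section Maximal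

variable (hM : IsLocal M) {Z : HRel M} (hZ : Maximal (· ∈ {Z : HRel M | Z.IsGood hM T}) Z)
  {P : LStructure L}

/-- The local model presented by `Z`. -/
abbrev model (hM : IsLocal M) {Z : HRel M} (hZ : Z.IsPre) : LStructure L :=
  (isPreLocal_str hM hZ).quot

/-- The interpretation in `P` of the names in use and of an additional tuple of witnesses. -/
def ext (hZ : Z.IsPre) (h : LHom (model hM hZ) P) (d : WitData M)
    (b : (j : _) → P.Dom (d.θ.τ j)) (s : L.Sorts) (x : HTerm M s) (y : P.Dom s) : Prop :=
  (∃ hx : Z.supp x, h.toFun s ((isPreLocal_str hM hZ).cls ⟨x, hx⟩) = y) ∨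
    ∃ (j : _) (hs : d.θ.τ j = s), hs ▸ d.wit j = x ∧ hs ▸ b j = y

theorem pos_cast {s s' : L.Sorts} (hs : s = s') (x : HTerm M s) : (hs ▸ x).pos = x.pos := by
  subst hs
  rfl

theorem le_of_maximal (hP : LocalModel P T) (h : LHom (model hM hZ.1.isPre) P) (d : WitData M)
    (b : (j : _) → P.Dom (d.θ.τ j)) (hnew : ∀ j, ¬ Z.supp (d.wit j))
    (hpin : ∀ j hj, ext hM hZ.1.isPre h d b _ (d.params j hj) (b j))
    (hat : ∀ {n : ℕ} (idx : Fin n → Fin d.θ.k) (R : L.Rel n (fun i => d.θ.τ (idx i))),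
      d.θ.atoms idx R → P.relMap R (fun i => b (idx i))) :
    pull P (ext hM hZ.1.isPre h d b) ≤ Z := by
  have hpre := isPreLocal_str hM hZ.1.isPre
  have hbase : ∀ s (m : M.Dom s), Z.supp (.base m) := fun s m =>
    hZ.1.isPre.base_loc ((hM.dd0_eq _ _).2 rfl)
  refine hZ.le_of_ge (isGood_pull hM hP ?_ (h.comp (hpre.clsHom.comp
    { toFun := fun s m => ⟨.base m, hbase s m⟩
      map_rel := fun R x hx => hZ.1.isPre.base R x hx
      map_const := fun _ => rfl })) (fun s m => Or.inl ⟨hbase s m, rfl⟩) ?_) ?_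
  · rintro s x y y' (⟨hx, rfl⟩ | ⟨j, rfl, rfl, rfl⟩) (⟨hx', rfl⟩ | ⟨j', hs, hx', rfl⟩)
    · rfl
    · subst hs
      subst hx'
      exact (hnew _ hx).elim
    · exact (hnew _ hx').elim
    · have hj := congrArg HTerm.pos hx'
      rw [pos_cast] at hj
      obtain rfl : j' = j := Fin.ext hj
      rfl
  · rintro s x y d' (⟨hx, rfl⟩ | ⟨j, rfl, rfl, rfl⟩) hd
    · have H := hZ.1.henkin x d' hx hd
      refine ⟨fun j => h.toFun _ (hpre.cls ⟨d'.wit j, H.supp j⟩), fun j => Or.inl ⟨_, rfl⟩,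
        fun j hj => Or.inl ⟨?_, ?_⟩, fun idx R hR => ?_⟩
      · exact hZ.1.isPre.supp_of_rel _ _ (H.pin j hj) 1
      · refine congrArg _ (hpre.cls_eq_cls.2 ((str_locRel _ _ _ _ _).2 ?_))
        exact hZ.1.isPre.symm _ _ _ (H.pin j hj)
      · exact h.map_rel R _ ((hpre.relMap_cls R _).2 (H.atoms idx R hR))
    · obtain rfl : d = d' := Option.some.inj hd
      exact ⟨b, fun j => Or.inr ⟨j, rfl, rfl, rfl⟩, hpin, hat⟩
  · intro n ρ R x hx
    exact ⟨_, fun i => Or.inl ⟨hZ.1.isPre.supp_of_rel R x hx i, rfl⟩,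
      h.map_rel R _ ((hpre.relMap_cls R _).2 hx)⟩

theorem relMap_of_maximal (hP : LocalModel P T) (h : LHom (model hM hZ.1.isPre) P) {n : ℕ}
    {ρ : Fin n → L.Sorts} (R : L.Rel n ρ) (x : (i : Fin n) → (model hM hZ.1.isPre).Dom (ρ i))
    (hR : P.relMap R (fun i => h.toFun _ (x i))) : (model hM hZ.1.isPre).relMap R x := by
  have hpre := isPreLocal_str hM hZ.1.isPre
  choose y hy using fun i => hpre.cls_surjective (x i)
  obtain rfl : (fun i => hpre.cls (y i)) = x := funext hy
  refine (hpre.relMap_cls R y).2 ?_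
  have H := le_of_maximal hM hZ hP h
    ⟨⟨0, fun j => j.elim0, fun _ => False, fun _ _ => False⟩, fun _ hj => hj.elim⟩
    (fun j => j.elim0) (fun j => j.elim0) (fun j => j.elim0) (fun _ _ hR => hR.elim)
  exact H _ _ R _ ⟨_, fun i => Or.inl ⟨(y i).2, rfl⟩, hR⟩

theorem injective_of_maximal (hP : LocalModel P T) (h : LHom (model hM hZ.1.isPre) P)
    (s : L.Sorts) : Function.Injective (h.toFun s) := by
  intro a b hab
  have hpre := isPreLocal_str hM hZ.1.isPre
  refine (hpre.isLocal_quot.dd0_eq a b).1 (relMap_of_maximal hM hZ hP h _ _ ?_)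
  have := (hP.1.dd0_eq _ _).2 hab
  unfold LStructure.locRel at this
  rwa [← comp_dpair (A := (model hM hZ.1.isPre).Dom) (B := P.Dom) h.toFun] at this

theorem witnesses_of_maximal (hP : LocalModel P T) (h : LHom (model hM hZ.1.isPre) P)
    (d : WitData M) (b : (j : _) → P.Dom (d.θ.τ j))
    (hpin : ∀ j hj, ∃ hx : Z.supp (d.params j hj),
      h.toFun _ ((isPreLocal_str hM hZ.1.isPre).cls ⟨_, hx⟩) = b j)
    (hat : ∀ {n : ℕ} (idx : Fin n → Fin d.θ.k) (R : L.Rel n (fun i => d.θ.τ (idx i))),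
      d.θ.atoms idx R → P.relMap R (fun i => b (idx i))) :
    Z.Witnesses d := by
  by_cases hnew : ∀ j, ¬ Z.supp (d.wit j)
  · have H := le_of_maximal hM hZ hP h d b hnew (fun j hj => Or.inl (hpin j hj)) hat
    have hb : ∀ j, ext hM hZ.1.isPre h d b _ (d.wit j) (b j) := fun j =>
      Or.inr ⟨j, rfl, rfl, rfl⟩
    exact
      { supp := fun j => H _ _ _ _ ((pull_supp hP.1 _).2 ⟨b j, hb j⟩)
        pin := fun j hj => H _ _ _ _ ((pull_loc _ _ _).2
          ⟨b j, b j, hb j, Or.inl (hpin j hj), (hP.1.dd0_eq _ _).2 rfl⟩)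
        atoms := fun idx R hR => H _ _ _ _ ⟨_, fun i => hb (idx i), hat idx R hR⟩ }
  · push Not at hnew
    obtain ⟨j, hj⟩ := hnew
    exact hZ.1.henkin _ d hj rfl

theorem isPosEmbedding_of_maximal (hP : LocalModel P T) (h : LHom (model hM hZ.1.isPre) P) :
    h.IsPosEmbedding := by
  intro α σ φ v hφ
  have hpre := isPreLocal_str hM hZ.1.isPre
  obtain ⟨F, hF⟩ := φ.exists_support _ hφ
  have hrep : ∀ j, (∃ q, h.toFun _ q = (F.get j).2) →
      ∃ y, h.toFun _ (hpre.cls y) = (F.get j).2 := by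
    rintro j ⟨q, hq⟩
    obtain ⟨y, rfl⟩ := hpre.cls_surjective q
    exact ⟨y, hq⟩
  choose y hy using hrep
  let d : WitData M :=
    { θ :=
        { k := F.length
          τ := fun j => (F.get j).1
          pin := fun j => ∃ q, h.toFun _ q = (F.get j).2
          atoms := fun idx R => P.relMap R (fun i => (F.get (idx i)).2) }
      params := fun j hj => (y j hj).1 }
  have W : Z.Witnesses d := witnesses_of_maximal hM hZ hP h d (fun j => (F.get j).2)
    (fun j hj => ⟨(y j hj).2, hy j hj⟩) (fun _ _ hR => hR)
  let w : ∀ j, (model hM hZ.1.isPre).Dom (F.get j).1 := fun j => hpre.cls ⟨d.wit j, W.supp j⟩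
  have hw : ∀ j q, h.toFun _ q = (F.get j).2 → q = w j := by
    intro j q hq
    refine (injective_of_maximal hM hZ hP h _ (hq.trans (hy j ⟨q, hq⟩).symm)).trans ?_
    exact (hpre.cls_eq_cls.2 ((str_locRel _ _ _ _ _).2 (W.pin j ⟨q, hq⟩))).symm
  let E : Type := Σ s, P.Dom s × (model hM hZ.1.isPre).Dom s
  have key : ∀ e ∈ F, ∀ q, h.toFun e.1 q = e.2 →
      ∃ j, (⟨e.1, e.2, q⟩ : E) = ⟨(F.get j).1, (F.get j).2, w j⟩ := by
    intro e he q hq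
    obtain ⟨j, rfl⟩ := List.mem_iff_get.1 he
    exact ⟨j, by rw [hw j q hq]⟩
  refine hF _ v (fun s e q => ∃ j, (⟨s, e, q⟩ : E) = ⟨(F.get j).1, (F.get j).2, w j⟩)
    ?_ (fun a ha => key _ ha _ rfl) (fun s c hc => key _ hc _ (h.map_const c)) ?_
  · intro e he
    obtain ⟨j, rfl⟩ := List.mem_iff_get.1 he
    exact ⟨w j, j, rfl⟩
  · intro n ρ R x q hq hR
    choose j hj using hq
    obtain rfl : (fun i => (F.get (j i)).1) = ρ :=
      funext fun i => (congrArg Sigma.fst (hj i)).symm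
    simp only [Sigma.mk.injEq, heq_eq_eq, true_and, Prod.mk.injEq] at hj
    obtain rfl : (fun i => (F.get (j i)).2) = x := funext fun i => (hj i).1.symm
    obtain rfl : (fun i => w (j i)) = q := funext fun i => (hj i).2.symm
    exact (hpre.relMap_cls R _).2 (W.atoms j R hR)

end Maximal

end HRel

/-- Every local model of `T` maps to a local positively closed model of `T`. -/
theorem exists_isPC {L : LocalLanguage} {T : Set (PosSentence L)} {M : LStructure L}
    (hM : LocalModel M T) : ∃ N : LStructure L, IsPC N T ∧ Nonempty (LHom M N) := by
  obtain ⟨Z₀, hZ₀⟩ := HRel.exists_isGood hM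
  obtain ⟨Z, -, hZ⟩ := zorn_le_nonempty₀ {Z : HRel M | Z.IsGood hM.1 T}
    (fun c hc hchain Z hZ => ⟨HRel.union c, HRel.isGood_union hM.1 hchain ⟨Z, hZ⟩ hc,
      fun _ => HRel.le_union⟩) Z₀ hZ₀
  have hpre := HRel.isPreLocal_str hM.1 hZ.1.isPre
  refine ⟨hpre.quot, ⟨hpre.localModel_quot hZ.1.neg, fun P h hP =>
    HRel.isPosEmbedding_of_maximal hM.1 hZ hP h⟩, ⟨hpre.clsHom.comp
    { toFun := fun s m => ⟨.base m, hZ.1.isPre.base_loc ((hM.1.dd0_eq _ _).2 rfl)⟩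
      map_rel := fun R x hx => hZ.1.isPre.base R x hx
      map_const := fun _ => rfl }⟩⟩

/-- For a pointed variable `(α, σ)`, a set `Γ` of local positive
formulas is a local positive type of `T` iff `Γ = ltp⁺_M(a)` for some local positively
closed model `M` of `T` and tuple `a ∈ M^x`. -/
theorem type_iff_type_of_tuple_in_pc_model
    {L : LocalLanguage} (T : Set (PosSentence L))
    (hT : IsNegLocalTheory T) (hsat : LocSat T)
    (α : Type) (σ : α → L.Sorts) (hpt : VPointed σ)
    (Γ : Set (LPosForm L α σ)) :
    IsLType T Γ ↔
      ∃ (M : LStructure L) (v : (a : α) → M.Dom (σ a)), IsPC M T ∧ Γ = ltp M v := by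
  constructor
  · rintro ⟨⟨M, v, hM, hv⟩, hmax⟩
    obtain ⟨N, hN, ⟨k⟩⟩ := exists_isPC hM
    exact ⟨N, fun a => k.toFun _ (v a), hN, (hmax _ ⟨N, _, hN.1, fun _ hφ => hφ⟩
      fun φ hφ => (hv φ hφ).map k φ v).symm⟩
  · rintro ⟨M, v, hM, rfl⟩
    exact hM.isLType_ltp hpt v
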